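/- Lemma 1: the restriction of the SP semantics ⟦·⟧ to the set of terms generated by the non-terminal N of the normal-form grammar is a bijection from the set of N-terms onto the collection of nonempty finite sets of SP graphs over 𝔹. -/

import Mathlib

/-!
Formalization of "Attack Trees with Sequential Conjunction".

Source-sink graphs over a set `B` of basic actions: a vertex type `V`,
a multiset of labeled edges, a source `s` and a sink `z` with `s ≠ z`.
-/

structure SSG (B : Type) : Type 1 where
  V : Type
  deq : DecidableEq V
  E : Multiset (V × B × V)
  s : V
  z : V
  ne : s ≠ z

namespace SSG

variable {B : Type}

/-- The graph with a single edge labeled `b`. -/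
def single (b : B) : SSG B where
  V := Bool
  deq := inferInstance
  E := {(false, b, true)}
  s := false
  z := true
  ne := Bool.false_ne_true

/-- In the sequential composition, the sink of the first graph is identified with
the source of the second graph. -/
def seqEmbed (G G' : SSG B) (v : G.V) : ({u : G.V // u ≠ G.z} ⊕ G'.V) :=
  haveI := G.deq
  if h : v = G.z then Sum.inr G'.s else Sum.inl ⟨v, h⟩

/-- Sequential composition `G ⋅ G'` of source-sink graphs: the disjoint union in which
the sink of `G` is identified with the source of `G'`. -/
def seq (G G' : SSG B) : SSG B where
  V := {u : G.V // u ≠ G.z} ⊕ G'.V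
  deq := by haveI := G.deq; haveI := G'.deq; infer_instance
  E := G.E.map (fun e => (G.seqEmbed G' e.1, e.2.1, G.seqEmbed G' e.2.2)) +
       G'.E.map (fun e => (Sum.inr e.1, e.2.1, Sum.inr e.2.2))
  s := Sum.inl ⟨G.s, G.ne⟩
  z := Sum.inr G'.z
  ne := by simp

/-- In the parallel composition, the two sources are identified and the two sinks
are identified. -/
def parEmbed (G G' : SSG B) (v : G.V) : ({u : G.V // u ≠ G.s ∧ u ≠ G.z} ⊕ G'.V) :=
  haveI := G.deq
  if hs : v = G.s then Sum.inr G'.s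
  else if hz : v = G.z then Sum.inr G'.z
  else Sum.inl ⟨v, hs, hz⟩

/-- Parallel composition `G ∥ G'` of source-sink graphs: the disjoint union in which
the two sources are identified and the two sinks are identified. -/
def par (G G' : SSG B) : SSG B where
  V := {u : G.V // u ≠ G.s ∧ u ≠ G.z} ⊕ G'.V
  deq := by haveI := G.deq; haveI := G'.deq; infer_instance
  E := G.E.map (fun e => (G.parEmbed G' e.1, e.2.1, G.parEmbed G' e.2.2)) +
       G'.E.map (fun e => (Sum.inr e.1, e.2.1, Sum.inr e.2.2))
  s := Sum.inr G'.s
  z := Sum.inr G'.z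
  ne := fun h => G'.ne (Sum.inr_injective h)

/-- Two source-sink graphs are equal (isomorphic) if there is a bijection between their
vertex sets that preserves the labeled edges (and hence source and sink). -/
def Iso (G G' : SSG B) : Prop :=
  ∃ f : G.V ≃ G'.V,
    G.E.map (fun e => (f e.1, e.2.1, f e.2.2)) = G'.E ∧ f G.s = G'.s ∧ f G.z = G'.z

/-- Directed adjacency: there is an edge from `u` to `v`. -/
def Adj (G : SSG B) (u v : G.V) : Prop := ∃ b, (u, b, v) ∈ G.E

/-- Series-parallel graphs (SP graphs): built from single edges by sequential and
parallel composition; as SP graphs are considered up to isomorphism, the collection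
is closed under isomorphism. -/
inductive IsSP : SSG B → Prop
  | single (b : B) : IsSP (single b)
  | seq {G G' : SSG B} : IsSP G → IsSP G' → IsSP (G.seq G')
  | par {G G' : SSG B} : IsSP G → IsSP G' → IsSP (G.par G')
  | iso {G G' : SSG B} : IsSP G → G.Iso G' → IsSP G'

/-- A graph is connected if any two vertices are joined by a path in the
underlying undirected graph. -/
def Connected (G : SSG B) : Prop :=
  ∀ u v : G.V, Relation.ReflTransGen (fun a b => G.Adj a b ∨ G.Adj b a) u v

/-- A directed graph is acyclic if it has no (nonempty) directed cycle. -/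
def Acyclic (G : SSG B) : Prop := ∀ v : G.V, ¬ Relation.TransGen G.Adj v v

end SSG
/-!
SAND attack trees: closed terms over `B ∪ {OR, AND, SAND}`, where the unranked
operators take `k ≥ 1` arguments (represented by nonempty lists `SandTreeList`).
-/

mutual
inductive SandTree (B : Type) : Type
  | atom : B → SandTree B
  | or : SandTreeList B → SandTree B
  | and : SandTreeList B → SandTree B
  | sand : SandTreeList B → SandTree B
inductive SandTreeList (B : Type) : Type
  | single : SandTree B → SandTreeList B
  | cons : SandTree B → SandTreeList B → SandTreeList B
end

namespace SandTreeList

variable {B : Type}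

def toList : SandTreeList B → List (SandTree B)
  | .single t => [t]
  | .cons t ts => t :: ts.toList

/-- Prepend a (possibly empty) list of trees to a nonempty argument list. -/
def glue : List (SandTree B) → SandTreeList B → SandTreeList B
  | [], ys => ys
  | x :: xs, ys => .cons x (glue xs ys)

/-- The nonempty argument list `t :: l`. -/
def ofList : SandTree B → List (SandTree B) → SandTreeList B
  | t, [] => .single t
  | t, u :: us => .cons t (ofList u us)

/-- Append a (possibly empty) list of trees to a nonempty argument list. -/
def snoc : SandTreeList B → List (SandTree B) → SandTreeList B
  | .single t, zs => ofList t zs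
  | .cons t ts, zs => .cons t (snoc ts zs)

def map (f : SandTree B → SandTree B) : SandTreeList B → SandTreeList B
  | .single t => .single (f t)
  | .cons t ts => .cons (f t) (map f ts)

end SandTreeList

/-!
The SP semantics `sem` interprets a SAND attack tree as a set of SP graphs
(sets of source-sink graphs closed under isomorphism, since SP graphs are
considered up to isomorphism):
`⟦b⟧ = {→b}`, `⟦OR(t₁,…,t_k)⟧ = ⋃ᵢ ⟦tᵢ⟧`,
`⟦AND(t₁,…,t_k)⟧ = {G₁ ∥ … ∥ G_k | Gᵢ ∈ ⟦tᵢ⟧}`,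
`⟦SAND(t₁,…,t_k)⟧ = {G₁ ⋅ … ⋅ G_k | Gᵢ ∈ ⟦tᵢ⟧}`.
-/

mutual
def sem {B : Type} : SandTree B → Set (SSG B)
  | .atom b => {G | (SSG.single b).Iso G}
  | .or ts => semOr ts
  | .and ts => semAnd ts
  | .sand ts => semSand ts
def semOr {B : Type} : SandTreeList B → Set (SSG B)
  | .single t => sem t
  | .cons t ts => sem t ∪ semOr ts
def semAnd {B : Type} : SandTreeList B → Set (SSG B)
  | .single t => sem t
  | .cons t ts => {G | ∃ G1 ∈ sem t, ∃ G2 ∈ semAnd ts, (G1.par G2).Iso G}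
def semSand {B : Type} : SandTreeList B → Set (SSG B)
  | .single t => sem t
  | .cons t ts => {G | ∃ G1 ∈ sem t, ∃ G2 ∈ semSand ts, (G1.seq G2).Iso G}
end
/-!
Equality of terms modulo commutativity of the unranked operators `OR` and `AND`
(the congruence generated by permuting the arguments of `OR` and `AND` nodes).
-/

mutual
inductive PEq {B : Type} : SandTree B → SandTree B → Prop
  | refl (t : SandTree B) : PEq t t
  | symm {t u : SandTree B} : PEq t u → PEq u t
  | trans {t u v : SandTree B} : PEq t u → PEq u v → PEq t v
  | orPerm {ts ts' : SandTreeList B} : ts.toList.Perm ts'.toList → PEq (.or ts) (.or ts')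
  | andPerm {ts ts' : SandTreeList B} : ts.toList.Perm ts'.toList → PEq (.and ts) (.and ts')
  | orCongr {ts ts' : SandTreeList B} : PEqL ts ts' → PEq (.or ts) (.or ts')
  | andCongr {ts ts' : SandTreeList B} : PEqL ts ts' → PEq (.and ts) (.and ts')
  | sandCongr {ts ts' : SandTreeList B} : PEqL ts ts' → PEq (.sand ts) (.sand ts')
inductive PEqL {B : Type} : SandTreeList B → SandTreeList B → Prop
  | single {t t' : SandTree B} : PEq t t' → PEqL (.single t) (.single t')
  | cons {t t' : SandTree B} {ts ts' : SandTreeList B} :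
      PEq t t' → PEqL ts ts' → PEqL (.cons t ts) (.cons t' ts')
end
/-!
Syntactic consequence from the axiom system `E_SP`.

The axiom schemes are represented by all of their instances (arbitrary argument
terms in place of the variable vectors `X⃗`, `Y⃗`, `Z⃗`); on closed terms this
generates exactly the same derivability relation as variables plus the
substitution rule.  Closure under "replacement in contexts" is represented by
the congruence rules for the three operators.
-/

section
open SandTreeList
mutual
inductive DerivSP {B : Type} : SandTree B → SandTree B → Prop
  /- closure rules -/
  | refl (t : SandTree B) : DerivSP t t
  | symm {t u : SandTree B} : DerivSP t u → DerivSP u t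
  | trans {t u v : SandTree B} : DerivSP t u → DerivSP u v → DerivSP t v
  | congrOr {ts ts' : SandTreeList B} : DerivSPL ts ts' → DerivSP (.or ts) (.or ts')
  | congrAnd {ts ts' : SandTreeList B} : DerivSPL ts ts' → DerivSP (.and ts) (.and ts')
  | congrSand {ts ts' : SandTreeList B} : DerivSPL ts ts' → DerivSP (.sand ts) (.sand ts')
  /- (E1) commutativity of OR -/
  | ax1 {ts ts' : SandTreeList B} : ts.toList.Perm ts'.toList → DerivSP (.or ts) (.or ts')
  /- (E2) commutativity of AND -/
  | ax2 {ts ts' : SandTreeList B} : ts.toList.Perm ts'.toList → DerivSP (.and ts) (.and ts')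
  /- (E3) OR(X⃗, OR(Y⃗)) = OR(X⃗, Y⃗) -/
  | ax3 (xs : List (SandTree B)) (ys : SandTreeList B) :
      DerivSP (.or (glue xs (.single (.or ys)))) (.or (glue xs ys))
  /- (E4) AND(X⃗, AND(Y⃗)) = AND(X⃗, Y⃗) -/
  | ax4 (xs : List (SandTree B)) (ys : SandTreeList B) :
      DerivSP (.and (glue xs (.single (.and ys)))) (.and (glue xs ys))
  /- (E4') SAND(X⃗, SAND(Y⃗), Z⃗) = SAND(X⃗, Y⃗, Z⃗) -/
  | ax4' (xs : List (SandTree B)) (ys : SandTreeList B) (zs : List (SandTree B)) :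
      DerivSP (.sand (glue xs (snoc (.single (.sand ys)) zs))) (.sand (glue xs (snoc ys zs)))
  /- (E5) OR(A) = A -/
  | ax5 (t : SandTree B) : DerivSP (.or (.single t)) t
  /- (E6) AND(A) = A -/
  | ax6 (t : SandTree B) : DerivSP (.and (.single t)) t
  /- (E6') SAND(A) = A -/
  | ax6' (t : SandTree B) : DerivSP (.sand (.single t)) t
  /- (E10) AND(X⃗, OR(Y⃗)) = OR(AND(X⃗,Y₁),…,AND(X⃗,Yₗ)) -/
  | ax10 (xs : List (SandTree B)) (ys : SandTreeList B) :
      DerivSP (.and (glue xs (.single (.or ys))))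
        (.or (SandTreeList.map (fun y => .and (glue xs (.single y))) ys))
  /- (E10') SAND(X⃗, OR(Y⃗), Z⃗) = OR(SAND(X⃗,Y₁,Z⃗),…,SAND(X⃗,Yₗ,Z⃗)) -/
  | ax10' (xs : List (SandTree B)) (ys : SandTreeList B) (zs : List (SandTree B)) :
      DerivSP (.sand (glue xs (snoc (.single (.or ys)) zs)))
        (.or (SandTreeList.map (fun y => .sand (glue xs (snoc (.single y) zs))) ys))
  /- (E11) OR(A, A, X⃗) = OR(A, X⃗) -/
  | ax11 (a : SandTree B) (xs : List (SandTree B)) :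
      DerivSP (.or (.cons a (ofList a xs))) (.or (ofList a xs))
inductive DerivSPL {B : Type} : SandTreeList B → SandTreeList B → Prop
  | single {t t' : SandTree B} : DerivSP t t' → DerivSPL (.single t) (.single t')
  | cons {t t' : SandTree B} {ts ts' : SandTreeList B} :
      DerivSP t t' → DerivSPL ts ts' → DerivSPL (.cons t ts) (.cons t' ts')
end
end

/-! Syntactic consequence from the SAND-free fragment
`E_SM = {E1, E2, E3, E4, E5, E6, E10, E11}` of `E_SP` (formulated over the full
signature of SAND attack trees). -/
section
open SandTreeList
mutual
inductive DerivSM {B : Type} : SandTree B → SandTree B → Prop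
  | refl (t : SandTree B) : DerivSM t t
  | symm {t u : SandTree B} : DerivSM t u → DerivSM u t
  | trans {t u v : SandTree B} : DerivSM t u → DerivSM u v → DerivSM t v
  | congrOr {ts ts' : SandTreeList B} : DerivSML ts ts' → DerivSM (.or ts) (.or ts')
  | congrAnd {ts ts' : SandTreeList B} : DerivSML ts ts' → DerivSM (.and ts) (.and ts')
  | congrSand {ts ts' : SandTreeList B} : DerivSML ts ts' → DerivSM (.sand ts) (.sand ts')
  | ax1 {ts ts' : SandTreeList B} : ts.toList.Perm ts'.toList → DerivSM (.or ts) (.or ts')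
  | ax2 {ts ts' : SandTreeList B} : ts.toList.Perm ts'.toList → DerivSM (.and ts) (.and ts')
  | ax3 (xs : List (SandTree B)) (ys : SandTreeList B) :
      DerivSM (.or (glue xs (.single (.or ys)))) (.or (glue xs ys))
  | ax4 (xs : List (SandTree B)) (ys : SandTreeList B) :
      DerivSM (.and (glue xs (.single (.and ys)))) (.and (glue xs ys))
  | ax5 (t : SandTree B) : DerivSM (.or (.single t)) t
  | ax6 (t : SandTree B) : DerivSM (.and (.single t)) t
  | ax10 (xs : List (SandTree B)) (ys : SandTreeList B) :
      DerivSM (.and (glue xs (.single (.or ys))))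
        (.or (SandTreeList.map (fun y => .and (glue xs (.single y))) ys))
  | ax11 (a : SandTree B) (xs : List (SandTree B)) :
      DerivSM (.or (.cons a (ofList a xs))) (.or (ofList a xs))
inductive DerivSML {B : Type} : SandTreeList B → SandTreeList B → Prop
  | single {t t' : SandTree B} : DerivSM t t' → DerivSML (.single t) (.single t')
  | cons {t t' : SandTree B} {ts ts' : SandTreeList B} :
      DerivSM t t' → DerivSML ts ts' → DerivSML (.cons t ts) (.cons t' ts')
end
end
/-!
The normal-form grammar (for `k ≥ 2`, `b ∈ B`):
`N ::= A | OR(A₁,…,A_k)` (with pairwise distinct `Aᵢ`),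
`A ::= C | S`, `C ::= b | AND(S₁,…,S_k)`, `S ::= b | SAND(C₁,…,C_k)`.
-/

mutual
inductive IsC {B : Type} : SandTree B → Prop
  | atom (b : B) : IsC (.atom b)
  | and {ts : SandTreeList B} : 2 ≤ ts.toList.length → IsSL ts → IsC (.and ts)
inductive IsS {B : Type} : SandTree B → Prop
  | atom (b : B) : IsS (.atom b)
  | sand {ts : SandTreeList B} : 2 ≤ ts.toList.length → IsCL ts → IsS (.sand ts)
inductive IsSL {B : Type} : SandTreeList B → Prop
  | single {t : SandTree B} : IsS t → IsSL (.single t)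
  | cons {t : SandTree B} {ts : SandTreeList B} : IsS t → IsSL ts → IsSL (.cons t ts)
inductive IsCL {B : Type} : SandTreeList B → Prop
  | single {t : SandTree B} : IsC t → IsCL (.single t)
  | cons {t : SandTree B} {ts : SandTreeList B} : IsC t → IsCL ts → IsCL (.cons t ts)
end

/-- Terms generated by the non-terminal `A` of the normal-form grammar. -/
def IsA {B : Type} (t : SandTree B) : Prop := IsC t ∨ IsS t

/-- Terms generated by the non-terminal `N` of the normal-form grammar; as terms
are considered modulo commutativity of `OR` and `AND`, the arguments of the `OR`
are required to be pairwise distinct modulo commutativity. -/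
def IsN {B : Type} (t : SandTree B) : Prop :=
  IsA t ∨ ∃ ts : SandTreeList B, t = .or ts ∧ 2 ≤ ts.toList.length ∧
    (∀ u ∈ ts.toList, IsA u) ∧ ts.toList.Pairwise (fun a b => ¬ PEq a b)

/-!
The term rewriting system obtained by orienting the axioms
(E3), (E4), (E4'), (E5), (E6), (E6'), (E10), (E10'), (E11) from left to right,
applied in any context, modulo commutativity of `OR` and `AND`.
-/

section
open SandTreeList

/-- Rule application at the root. -/
inductive RStep {B : Type} : SandTree B → SandTree B → Prop
  | r3 (xs : List (SandTree B)) (ys : SandTreeList B) :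
      RStep (.or (glue xs (.single (.or ys)))) (.or (glue xs ys))
  | r4 (xs : List (SandTree B)) (ys : SandTreeList B) :
      RStep (.and (glue xs (.single (.and ys)))) (.and (glue xs ys))
  | r4' (xs : List (SandTree B)) (ys : SandTreeList B) (zs : List (SandTree B)) :
      RStep (.sand (glue xs (snoc (.single (.sand ys)) zs))) (.sand (glue xs (snoc ys zs)))
  | r5 (t : SandTree B) : RStep (.or (.single t)) t
  | r6 (t : SandTree B) : RStep (.and (.single t)) t
  | r6' (t : SandTree B) : RStep (.sand (.single t)) t
  | r10 (xs : List (SandTree B)) (ys : SandTreeList B) :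
      RStep (.and (glue xs (.single (.or ys))))
        (.or (SandTreeList.map (fun y => .and (glue xs (.single y))) ys))
  | r10' (xs : List (SandTree B)) (ys : SandTreeList B) (zs : List (SandTree B)) :
      RStep (.sand (glue xs (snoc (.single (.or ys)) zs)))
        (.or (SandTreeList.map (fun y => .sand (glue xs (snoc (.single y) zs))) ys))
  | r11 (a : SandTree B) (xs : List (SandTree B)) :
      RStep (.or (.cons a (ofList a xs))) (.or (ofList a xs))

end

/-! Rule application in an arbitrary context. -/
mutual
inductive Rw {B : Type} : SandTree B → SandTree B → Prop
  | root {t t' : SandTree B} : RStep t t' → Rw t t'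
  | or {ts ts' : SandTreeList B} : RwL ts ts' → Rw (.or ts) (.or ts')
  | and {ts ts' : SandTreeList B} : RwL ts ts' → Rw (.and ts) (.and ts')
  | sand {ts ts' : SandTreeList B} : RwL ts ts' → Rw (.sand ts) (.sand ts')
inductive RwL {B : Type} : SandTreeList B → SandTreeList B → Prop
  | single {t t' : SandTree B} : Rw t t' → RwL (.single t) (.single t')
  | head {t t' : SandTree B} {ts : SandTreeList B} : Rw t t' → RwL (.cons t ts) (.cons t' ts)
  | tail {t : SandTree B} {ts ts' : SandTreeList B} : RwL ts ts' → RwL (.cons t ts) (.cons t ts')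
end

/-- One rewrite step of the TRS `⇒`, working modulo commutativity of `OR` and `AND`. -/
def RwMod {B : Type} (t t' : SandTree B) : Prop :=
  ∃ u u' : SandTree B, PEq t u ∧ Rw u u' ∧ PEq u' t'

/-- Zero or more rewrite steps (modulo commutativity of `OR` and `AND`). -/
def RwStar {B : Type} : SandTree B → SandTree B → Prop :=
  Relation.ReflTransGen (fun a b => PEq a b ∨ Rw a b)

/-- A normal form: no rewrite rule is applicable, modulo commutativity of `OR` and `AND`. -/
def NormalForm {B : Type} (t : SandTree B) : Prop :=
  ∀ u t' : SandTree B, PEq t u → ¬ Rw u t'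

/-! The norm `‖·‖`: `‖b‖ = 1`, `‖OR(t₁,…,t_k)‖ = ‖t₁‖+…+‖t_k‖+2`,
`‖AND(t₁,…,t_k)‖ = ‖SAND(t₁,…,t_k)‖ = 2·‖t₁‖·…·‖t_k‖`. -/
mutual
def weight {B : Type} : SandTree B → ℕ
  | .atom _ => 1
  | .or ts => weightSum ts + 2
  | .and ts => 2 * weightProd ts
  | .sand ts => 2 * weightProd ts
def weightSum {B : Type} : SandTreeList B → ℕ
  | .single t => weight t
  | .cons t ts => weight t + weightSum ts
def weightProd {B : Type} : SandTreeList B → ℕ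
  | .single t => weight t
  | .cons t ts => weight t * weightProd ts
end
/-!
Standard attack trees are SAND attack trees containing no `SAND` operator.
The multiset semantics maps a standard attack tree to a set of finite multisets
over `B`: `⟦b⟧_M = {⟨b⟩}`, `⟦OR⟧_M = ⋃ᵢ ⟦tᵢ⟧_M`,
`⟦AND⟧_M = {M₁ ⊎ … ⊎ M_k | Mᵢ ∈ ⟦tᵢ⟧_M}`.
(Its value on trees containing `SAND` is irrelevant and set to `∅`.)
-/

mutual
inductive NoSand {B : Type} : SandTree B → Prop
  | atom (b : B) : NoSand (.atom b)
  | or {ts : SandTreeList B} : NoSandL ts → NoSand (.or ts)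
  | and {ts : SandTreeList B} : NoSandL ts → NoSand (.and ts)
inductive NoSandL {B : Type} : SandTreeList B → Prop
  | single {t : SandTree B} : NoSand t → NoSandL (.single t)
  | cons {t : SandTree B} {ts : SandTreeList B} : NoSand t → NoSandL ts → NoSandL (.cons t ts)
end

mutual
def msem {B : Type} : SandTree B → Set (Multiset B)
  | .atom b => {({b} : Multiset B)}
  | .or ts => msemOr ts
  | .and ts => msemAnd ts
  | .sand _ => ∅
def msemOr {B : Type} : SandTreeList B → Set (Multiset B)
  | .single t => msem t
  | .cons t ts => msem t ∪ msemOr ts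
def msemAnd {B : Type} : SandTreeList B → Set (Multiset B)
  | .single t => msem t
  | .cons t ts => {M | ∃ M1 ∈ msem t, ∃ M2 ∈ msemAnd ts, M = M1 + M2}
end

/-- Parallel composition of a nonempty list of graphs `G ∥ H₁ ∥ … ∥ H_k`. -/
def parAll {B : Type} : SSG B → List (SSG B) → SSG B
  | G, [] => G
  | G, H :: Hs => parAll (G.par H) Hs

/-- SAND attack trees modulo equivalence with respect to the SP semantics
(`t ~ t'` iff `⟦t⟧ = ⟦t'⟧`). -/
def semSetoid (B : Type) : Setoid (SandTree B) :=
  ⟨fun t t' => sem t = sem t', fun _ => rfl, Eq.symm, Eq.trans⟩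

/-- The map induced by the SP semantics on equivalence classes of SAND attack trees. -/
def semClass {B : Type} : Quotient (semSetoid B) → Set (SSG B) :=
  Quotient.lift sem (fun _ _ h => h)

/-!
Bottom-up evaluation of the minimal attack time attribute on SAND attack trees:
`α(b) = β(b)`, `α(OR) = min`, `α(AND) = max`, `α(SAND) = Σ`.
-/

mutual
def attr {B : Type} (β : B → NNReal) : SandTree B → NNReal
  | .atom b => β b
  | .or ts => attrOr β ts
  | .and ts => attrAnd β ts
  | .sand ts => attrSand β ts
def attrOr {B : Type} (β : B → NNReal) : SandTreeList B → NNReal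
  | .single t => attr β t
  | .cons t ts => min (attr β t) (attrOr β ts)
def attrAnd {B : Type} (β : B → NNReal) : SandTreeList B → NNReal
  | .single t => attr β t
  | .cons t ts => max (attr β t) (attrAnd β ts)
def attrSand {B : Type} (β : B → NNReal) : SandTreeList B → NNReal
  | .single t => attr β t
  | .cons t ts => attr β t + attrSand β ts
end
/-!
Standard attack trees as a standalone signature (`B ∪ {OR, AND}`, unranked
operators with `k ≥ 1` arguments), their multiset semantics, and syntactic
consequence from the axiom system `E_SM`.
-/

mutual
inductive ATree (B : Type) : Type
  | atom : B → ATree B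
  | or : ATreeList B → ATree B
  | and : ATreeList B → ATree B
inductive ATreeList (B : Type) : Type
  | single : ATree B → ATreeList B
  | cons : ATree B → ATreeList B → ATreeList B
end

namespace ATreeList

variable {B : Type}

def toList : ATreeList B → List (ATree B)
  | .single t => [t]
  | .cons t ts => t :: ts.toList

def glue : List (ATree B) → ATreeList B → ATreeList B
  | [], ys => ys
  | x :: xs, ys => .cons x (glue xs ys)

def ofList : ATree B → List (ATree B) → ATreeList B
  | t, [] => .single t
  | t, u :: us => .cons t (ofList u us)

def map (f : ATree B → ATree B) : ATreeList B → ATreeList B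
  | .single t => .single (f t)
  | .cons t ts => .cons (f t) (map f ts)

end ATreeList

/-! The multiset semantics of standard attack trees. -/

mutual
def amsem {B : Type} : ATree B → Set (Multiset B)
  | .atom b => {({b} : Multiset B)}
  | .or ts => amsemOr ts
  | .and ts => amsemAnd ts
def amsemOr {B : Type} : ATreeList B → Set (Multiset B)
  | .single t => amsem t
  | .cons t ts => amsem t ∪ amsemOr ts
def amsemAnd {B : Type} : ATreeList B → Set (Multiset B)
  | .single t => amsem t
  | .cons t ts => {M | ∃ M1 ∈ amsem t, ∃ M2 ∈ amsemAnd ts, M = M1 + M2}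
end

/-!
Syntactic consequence from `E_SM = {E1, E2, E3, E4, E5, E6, E10, E11}`.
Axiom schemes are represented by all of their instances (closure under
substitution is then automatic), and closure under replacement in contexts is
represented by the congruence rules.
-/

section
open ATreeList
mutual
inductive DerivASM {B : Type} : ATree B → ATree B → Prop
  | refl (t : ATree B) : DerivASM t t
  | symm {t u : ATree B} : DerivASM t u → DerivASM u t
  | trans {t u v : ATree B} : DerivASM t u → DerivASM u v → DerivASM t v
  | congrOr {ts ts' : ATreeList B} : DerivASML ts ts' → DerivASM (.or ts) (.or ts')
  | congrAnd {ts ts' : ATreeList B} : DerivASML ts ts' → DerivASM (.and ts) (.and ts')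
  /- (E1) -/
  | ax1 {ts ts' : ATreeList B} : ts.toList.Perm ts'.toList → DerivASM (.or ts) (.or ts')
  /- (E2) -/
  | ax2 {ts ts' : ATreeList B} : ts.toList.Perm ts'.toList → DerivASM (.and ts) (.and ts')
  /- (E3) -/
  | ax3 (xs : List (ATree B)) (ys : ATreeList B) :
      DerivASM (.or (glue xs (.single (.or ys)))) (.or (glue xs ys))
  /- (E4) -/
  | ax4 (xs : List (ATree B)) (ys : ATreeList B) :
      DerivASM (.and (glue xs (.single (.and ys)))) (.and (glue xs ys))
  /- (E5) -/
  | ax5 (t : ATree B) : DerivASM (.or (.single t)) t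
  /- (E6) -/
  | ax6 (t : ATree B) : DerivASM (.and (.single t)) t
  /- (E10) -/
  | ax10 (xs : List (ATree B)) (ys : ATreeList B) :
      DerivASM (.and (glue xs (.single (.or ys))))
        (.or (ATreeList.map (fun y => .and (glue xs (.single y))) ys))
  /- (E11) -/
  | ax11 (a : ATree B) (xs : List (ATree B)) :
      DerivASM (.or (.cons a (ofList a xs))) (.or (ofList a xs))
inductive DerivASML {B : Type} : ATreeList B → ATreeList B → Prop
  | single {t t' : ATree B} : DerivASM t t' → DerivASML (.single t) (.single t')
  | cons {t t' : ATree B} {ts ts' : ATreeList B} :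
      DerivASM t t' → DerivASML ts ts' → DerivASML (.cons t ts) (.cons t' ts')
end
end

section Decomposition

variable {α β B : Type}

/-- All elements of `E` are related to all elements of `F`. -/
def Precedes (r : α → α → Prop) (E F : Multiset α) : Prop :=
  ∀ e ∈ E, ∀ f ∈ F, r e f

/-- No element of `E` is related to an element of `F`, in either direction. -/
def Unrelated (r : α → α → Prop) (E F : Multiset α) : Prop :=
  ∀ e ∈ E, ∀ f ∈ F, ¬ r e f ∧ ¬ r f e

/-! `SPRep r lab t E`: the labeled relational structure on the multiset `E` is
series-parallel, and decomposed as prescribed by the `OR`-free term `t`. -/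
mutual
inductive SPRep (r : α → α → Prop) (lab : α → B) : SandTree B → Multiset α → Prop
  | atom (e : α) : SPRep r lab (.atom (lab e)) {e}
  | and {ts : SandTreeList B} {E : Multiset α} :
      SPRepAnd r lab ts.toList E → SPRep r lab (.and ts) E
  | sand {ts : SandTreeList B} {E : Multiset α} :
      SPRepSand r lab ts.toList E → SPRep r lab (.sand ts) E
inductive SPRepAnd (r : α → α → Prop) (lab : α → B) : List (SandTree B) → Multiset α → Prop
  | nil : SPRepAnd r lab [] 0
  | cons {t : SandTree B} {ts : List (SandTree B)} {E F : Multiset α} :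
      SPRep r lab t E → SPRepAnd r lab ts F → Unrelated r E F → SPRepAnd r lab (t :: ts) (E + F)
inductive SPRepSand (r : α → α → Prop) (lab : α → B) : List (SandTree B) → Multiset α → Prop
  | empty : SPRepSand r lab [] 0
  | prepend {t : SandTree B} {ts : List (SandTree B)} {E F : Multiset α} :
      SPRep r lab t E → SPRepSand r lab ts F → Precedes r E F → SPRepSand r lab (t :: ts) (E + F)
end

variable {r : α → α → Prop} {lab : α → B}

namespace SandTreeList

theorem toList_ne_nil (ts : SandTreeList B) : ts.toList ≠ [] := by
  cases ts <;> simp [toList]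

theorem toList_ofList (t : SandTree B) (l : List (SandTree B)) :
    (ofList t l).toList = t :: l := by
  induction l generalizing t with
  | nil => rfl
  | cons u us ih => simp [ofList, toList, ih]

theorem toList_injective : Function.Injective (toList (B := B))
  | .single t, .single u, h => by simp_all [toList]
  | .single t, .cons u us, h => absurd h.symm (by simp [toList, us.toList_ne_nil])
  | .cons t ts, .single u, h => by simp_all [toList, ts.toList_ne_nil]
  | .cons t ts, .cons u us, h => by
      simp only [toList, List.cons.injEq] at h
      rw [h.1, toList_injective h.2]

theorem exists_toList_eq {l : List (SandTree B)} (hl : l ≠ []) :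
    ∃ ts : SandTreeList B, ts.toList = l := by
  cases l with
  | nil => exact absurd rfl hl
  | cons t l => exact ⟨ofList t l, toList_ofList t l⟩

theorem sizeOf_lt_of_mem_toList : ∀ {ts : SandTreeList B} {t : SandTree B},
    t ∈ ts.toList → sizeOf t < sizeOf ts
  | .single u, t, h => by
      obtain rfl : t = u := by simpa [toList] using h
      simp
  | .cons u us, t, h => by
      rcases List.mem_cons.1 h with rfl | h
      · simp; omega
      · have := sizeOf_lt_of_mem_toList h
        simp; omega

theorem exists_peqL_of_forall₂ : ∀ {ts : SandTreeList B} {l : List (SandTree B)},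
    List.Forall₂ PEq ts.toList l → ∃ us : SandTreeList B, us.toList = l ∧ PEqL ts us
  | .single t, l, h => by
      rw [toList, List.forall₂_cons_left_iff] at h
      obtain ⟨u, l', hu, hl', rfl⟩ := h
      rw [List.forall₂_nil_left_iff] at hl'
      subst hl'
      exact ⟨.single u, rfl, .single hu⟩
  | .cons t ts, l, h => by
      rw [toList, List.forall₂_cons_left_iff] at h
      obtain ⟨u, l', hu, hl', rfl⟩ := h
      obtain ⟨us, rfl, hus⟩ := exists_peqL_of_forall₂ hl'
      exact ⟨.cons u us, rfl, .cons hu hus⟩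

theorem forall_isS_of_isSL {ts : SandTreeList B} (h : IsSL ts) :
    ∀ t ∈ ts.toList, IsS t := by
  cases h with
  | single h => simpa [toList] using h
  | cons h hs => simpa [toList] using ⟨h, forall_isS_of_isSL hs⟩

theorem forall_isC_of_isCL {ts : SandTreeList B} (h : IsCL ts) :
    ∀ t ∈ ts.toList, IsC t := by
  cases h with
  | single h => simpa [toList] using h
  | cons h hs => simpa [toList] using ⟨h, forall_isC_of_isCL hs⟩

theorem isSL_of_forall_isS : ∀ {ts : SandTreeList B}, (∀ t ∈ ts.toList, IsS t) → IsSL ts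
  | .single t, h => .single (h t (by simp [toList]))
  | .cons t ts, h => .cons (h t (by simp [toList]))
      (isSL_of_forall_isS fun u hu => h u (by simp [toList, hu]))

theorem isCL_of_forall_isC : ∀ {ts : SandTreeList B}, (∀ t ∈ ts.toList, IsC t) → IsCL ts
  | .single t, h => .single (h t (by simp [toList]))
  | .cons t ts, h => .cons (h t (by simp [toList]))
      (isCL_of_forall_isC fun u hu => h u (by simp [toList, hu]))

end SandTreeList

theorem SPRep.ne_zero {t : SandTree B} {E : Multiset α} (h : SPRep r lab t E) : E ≠ 0 := by
  induction h using SPRep.rec (motive_2 := fun l E _ => l ≠ [] → E ≠ 0)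
    (motive_3 := fun l E _ => l ≠ [] → E ≠ 0) with
  | atom e => simp
  | and _ ih => exact ih (SandTreeList.toList_ne_nil _)
  | sand _ ih => exact ih (SandTreeList.toList_ne_nil _)
  | nil => contradiction
  | cons _ _ _ ih => simp [ih]
  | empty => contradiction
  | prepend _ _ _ ih => simp [ih]

theorem SPRepAnd.ne_zero {l : List (SandTree B)} {E : Multiset α} (h : SPRepAnd r lab l E)
    (hl : l ≠ []) : E ≠ 0 := by
  cases h with
  | nil => exact absurd rfl hl
  | cons h _ _ => simp [h.ne_zero]

theorem SPRepSand.ne_zero {l : List (SandTree B)} {E : Multiset α} (h : SPRepSand r lab l E)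
    (hl : l ≠ []) : E ≠ 0 := by
  cases h with
  | empty => exact absurd rfl hl
  | prepend h _ _ => simp [h.ne_zero]

theorem SPRepAnd.exists_add {l : List (SandTree B)} {E : Multiset α} (h : SPRepAnd r lab l E)
    (hl : 2 ≤ l.length) : ∃ X Y, E = X + Y ∧ X ≠ 0 ∧ Y ≠ 0 ∧ Unrelated r X Y := by
  cases h with
  | nil => simp at hl
  | @cons t ts X Y h hs hr =>
    refine ⟨X, Y, rfl, h.ne_zero, hs.ne_zero ?_, hr⟩
    rintro rfl
    simp at hl

theorem SPRepSand.exists_add {l : List (SandTree B)} {E : Multiset α} (h : SPRepSand r lab l E)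
    (hl : 2 ≤ l.length) : ∃ X Y, E = X + Y ∧ X ≠ 0 ∧ Y ≠ 0 ∧ Precedes r X Y := by
  cases h with
  | empty => simp at hl
  | @prepend t ts X Y h hs hr =>
    refine ⟨X, Y, rfl, h.ne_zero, hs.ne_zero ?_, hr⟩
    rintro rfl
    simp at hl

/-- A parallel decomposition and a series decomposition cannot both be proper. -/
theorem not_unrelated_of_precedes {X Y X' Y' : Multiset α} (h : X + Y = X' + Y')
    (hX : X ≠ 0) (hY : Y ≠ 0) (hX' : X' ≠ 0) (hY' : Y' ≠ 0)
    (hu : Unrelated r X Y) : ¬ Precedes r X' Y' := by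
  intro hp
  obtain ⟨x, hx⟩ := Multiset.exists_mem_of_ne_zero hX
  obtain ⟨y, hy⟩ := Multiset.exists_mem_of_ne_zero hY
  obtain ⟨x', hx'⟩ := Multiset.exists_mem_of_ne_zero hX'
  obtain ⟨y', hy'⟩ := Multiset.exists_mem_of_ne_zero hY'
  have key : ∀ e, e ∈ X ∨ e ∈ Y ↔ e ∈ X' ∨ e ∈ Y' := fun e => by
    rw [← Multiset.mem_add, h, Multiset.mem_add]
  unfold Unrelated Precedes at *
  have := key x
  have := key y
  have := key x'
  have := key y'
  grind

theorem singleton_eq_add {e : α} {X Y : Multiset α} (h : {e} = X + Y) : X = 0 ∨ Y = 0 := by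
  have := congrArg Multiset.card h
  rw [Multiset.card_singleton, Multiset.card_add] at this
  rw [← Multiset.card_eq_zero, ← Multiset.card_eq_zero]
  omega

theorem IsC.eq_zero_or_eq_zero {t : SandTree B} (ht : IsC t) {X Y : Multiset α}
    (h : SPRep r lab t (X + Y)) (hp : Precedes r X Y) : X = 0 ∨ Y = 0 := by
  generalize hE : X + Y = E at h
  cases ht with
  | atom b => cases h with | atom e => exact singleton_eq_add hE.symm
  | and hlen _ =>
    cases h with
    | and h =>
      obtain ⟨X', Y', rfl, hX', hY', hu⟩ := h.exists_add hlen
      by_contra! hne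
      exact not_unrelated_of_precedes hE.symm hX' hY' hne.1 hne.2 hu hp

theorem IsS.eq_zero_or_eq_zero {t : SandTree B} (ht : IsS t) {X Y : Multiset α}
    (h : SPRep r lab t (X + Y)) (hu : Unrelated r X Y) : X = 0 ∨ Y = 0 := by
  generalize hE : X + Y = E at h
  cases ht with
  | atom b => cases h with | atom e => exact singleton_eq_add hE.symm
  | sand hlen _ =>
    cases h with
    | sand h =>
      obtain ⟨X', Y', rfl, hX', hY', hp⟩ := h.exists_add hlen
      by_contra! hne
      exact not_unrelated_of_precedes hE hne.1 hne.2 hX' hY' hu hp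

theorem Precedes.mono {X Y X' Y' : Multiset α} (h : Precedes r X Y) (hX : X' ≤ X)
    (hY : Y' ≤ Y) : Precedes r X' Y' :=
  fun e he f hf => h e (Multiset.mem_of_le hX he) f (Multiset.mem_of_le hY hf)

theorem Unrelated.mono {X Y X' Y' : Multiset α} (h : Unrelated r X Y) (hX : X' ≤ X)
    (hY : Y' ≤ Y) : Unrelated r X' Y' :=
  fun e he f hf => h e (Multiset.mem_of_le hX he) f (Multiset.mem_of_le hY hf)

open scoped Classical in
theorem IsC.le_of_add_eq {t : SandTree B} (ht : IsC t) {X Y X' Y' : Multiset α}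
    (h : SPRep r lab t X) (hE : X + Y = X' + Y') (hX' : X' ≠ 0)
    (hr : ∀ e ∈ X + Y, ∀ f ∈ X + Y, r e f → ¬ r f e)
    (hp : Precedes r X Y) (hp' : Precedes r X' Y') : X ≤ X' := by
  have hsub : X - X' ≤ Y' := by
    rw [tsub_le_iff_left, ← hE]
    exact Multiset.le_add_right _ _
  have hsplit : X ∩ X' + (X - X') = X := by
    rw [add_comm, Multiset.sub_add_inter]
  rcases ht.eq_zero_or_eq_zero (hsplit.symm ▸ h)
    (hp'.mono (Multiset.inter_le_right) hsub) with h0 | h0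
  · exfalso
    rw [h0, zero_add] at hsplit
    rw [hsplit] at hsub
    obtain ⟨x, hx⟩ := Multiset.exists_mem_of_ne_zero h.ne_zero
    obtain ⟨x', hx'⟩ := Multiset.exists_mem_of_ne_zero hX'
    have hxE : x ∈ X + Y := Multiset.mem_add.2 (.inl hx)
    have hxE' : x' ∈ X + Y := hE ▸ Multiset.mem_add.2 (.inl hx')
    have h1 := hp' x' hx' x (Multiset.mem_of_le hsub hx)
    rcases Multiset.mem_add.1 hxE' with hx1 | hx1
    · have h2 := hp' x' hx' x' (Multiset.mem_of_le hsub hx1)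
      exact hr _ hxE' _ hxE' h2 h2
    · exact hr _ hxE' _ hxE h1 (hp x hx x' hx1)
  · exact tsub_eq_zero_iff_le.1 h0

open scoped Classical in
theorem IsS.le_of_add_eq {t : SandTree B} (ht : IsS t) {X Y X' Y' : Multiset α}
    (h : SPRep r lab t X) (hE : X + Y = X' + Y') {x : α} (hx : x ∈ X) (hx' : x ∈ X')
    (hu' : Unrelated r X' Y') : X ≤ X' := by
  have hsub : X - X' ≤ Y' := by
    rw [tsub_le_iff_left, ← hE]
    exact Multiset.le_add_right _ _
  have hsplit : X ∩ X' + (X - X') = X := by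
    rw [add_comm, Multiset.sub_add_inter]
  rcases ht.eq_zero_or_eq_zero (hsplit.symm ▸ h)
    (hu'.mono (Multiset.inter_le_right) hsub) with h0 | h0
  · have := Multiset.mem_inter.2 ⟨hx, hx'⟩
    simp [h0] at this
  · exact tsub_eq_zero_iff_le.1 h0

theorem SPRepAnd.exists_perm_cons {l : List (SandTree B)} {E : Multiset α}
    (h : SPRepAnd r lab l E) {x : α} (hx : x ∈ E) :
    ∃ t l' X Y, l.Perm (t :: l') ∧ E = X + Y ∧ x ∈ X ∧ SPRep r lab t X ∧
      SPRepAnd r lab l' Y ∧ Unrelated r X Y := by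
  induction l generalizing E with
  | nil => cases h; simp at hx
  | cons t l ih =>
    cases h with
    | @cons _ _ X Y ht hl hu =>
      rcases Multiset.mem_add.1 hx with hx | hx
      · exact ⟨t, l, X, Y, .refl _, rfl, hx, ht, hl, hu⟩
      · obtain ⟨t', l', X', Y', hperm, rfl, hx', ht', hl', hu'⟩ := ih hl hx
        have hXY' := hu.mono le_rfl (Multiset.le_add_left Y' X')
        have hXX' := hu.mono le_rfl (Multiset.le_add_right X' Y')
        refine ⟨t', t :: l', X', X + Y', (hperm.cons t).trans (.swap _ _ _), ?_, hx', ht',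
          .cons ht hl' hXY', ?_⟩
        · rw [add_left_comm]
        · intro e he f hf
          rcases Multiset.mem_add.1 hf with hf | hf
          · exact (hXX' f hf e he).symm
          · exact hu' e he f hf

theorem SPRepSand.forall₂_peq {l₁ l₂ : List (SandTree B)} {E : Multiset α}
    (h₁ : SPRepSand r lab l₁ E) (h₂ : SPRepSand r lab l₂ E)
    (hr : ∀ e ∈ E, ∀ f ∈ E, r e f → ¬ r f e)
    (hC₁ : ∀ t ∈ l₁, IsC t) (hC₂ : ∀ t ∈ l₂, IsC t)
    (ih : ∀ t ∈ l₁, ∀ u ∈ l₂, ∀ X ≤ E, SPRep r lab t X → SPRep r lab u X → PEq t u) :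
    List.Forall₂ PEq l₁ l₂ := by
  induction l₁ generalizing l₂ E with
  | nil =>
    cases h₁
    cases l₂ with
    | nil => exact .nil
    | cons => exact absurd rfl (h₂.ne_zero (by simp))
  | cons t l₁ ihl =>
    cases l₂ with
    | nil => cases h₂; exact absurd rfl (h₁.ne_zero (by simp))
    | cons u l₂ =>
      generalize hE : E = F at h₂
      cases h₁ with
      | @prepend _ _ X Y ht hl hp =>
        cases h₂ with
        | @prepend _ _ X' Y' hu hl' hp' =>
          have hX : X = X' := le_antisymm
            ((hC₁ t (by simp)).le_of_add_eq ht hE hu.ne_zero hr hp hp')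
            ((hC₂ u (by simp)).le_of_add_eq hu hE.symm ht.ne_zero (hE ▸ hr) hp' hp)
          subst hX
          obtain rfl : Y = Y' := add_left_cancel hE
          refine .cons (ih t (by simp) u (by simp) X (Multiset.le_add_right _ _) ht hu) ?_
          refine ihl hl hl' (fun e he f hf => hr e (by simp [he]) f (by simp [hf]))
            (fun t ht => hC₁ t (by simp [ht])) (fun t ht => hC₂ t (by simp [ht])) ?_
          exact fun t ht u hu Z hZ => ih t (by simp [ht]) u (by simp [hu]) Z
            (hZ.trans (Multiset.le_add_left _ _))

theorem SPRepAnd.exists_perm_forall₂_peq {l₁ l₂ : List (SandTree B)} {E : Multiset α}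
    (h₁ : SPRepAnd r lab l₁ E) (h₂ : SPRepAnd r lab l₂ E)
    (hS₁ : ∀ t ∈ l₁, IsS t) (hS₂ : ∀ t ∈ l₂, IsS t)
    (ih : ∀ t ∈ l₁, ∀ u ∈ l₂, ∀ X ≤ E, SPRep r lab t X → SPRep r lab u X → PEq t u) :
    ∃ l, List.Forall₂ PEq l₁ l ∧ l.Perm l₂ := by
  induction l₁ generalizing l₂ E with
  | nil =>
    cases h₁
    cases l₂ with
    | nil => exact ⟨[], .nil, .refl _⟩
    | cons => exact absurd rfl (h₂.ne_zero (by simp))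
  | cons t l₁ ihl =>
    cases h₁ with
    | @cons _ _ X Y ht hl hr =>
      obtain ⟨x, hx⟩ := Multiset.exists_mem_of_ne_zero ht.ne_zero
      obtain ⟨u, l', X', Y', hperm, hE, hx', hu, hl', hr'⟩ :=
        h₂.exists_perm_cons (x := x) (by simp [hx])
      have hmem : ∀ v, v ∈ u :: l' → v ∈ l₂ := fun v => hperm.mem_iff.2
      have hX : X = X' := le_antisymm
        ((hS₁ t (by simp)).le_of_add_eq ht hE hx hx' hr')
        ((hS₂ u (hmem u (by simp))).le_of_add_eq hu hE.symm hx' hx hr)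
      subst hX
      obtain rfl : Y = Y' := add_left_cancel hE
      obtain ⟨l, hl, hlp⟩ := ihl hl hl' (fun t ht => hS₁ t (by simp [ht]))
        (fun t ht => hS₂ t (hmem t (by simp [ht])))
        (fun t ht u hu Z hZ => ih t (by simp [ht]) u (hmem u (by simp [hu])) Z
          (hZ.trans (Multiset.le_add_left _ _)))
      exact ⟨u :: l, .cons (ih t (by simp) u (hmem u (by simp)) X
        (Multiset.le_add_right _ _) ht hu) hl, (hlp.cons u).trans hperm.symm⟩

theorem IsA.cases {t : SandTree B} (h : IsA t) :
    (∃ b, t = .atom b) ∨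
    (∃ ts : SandTreeList B, t = .and ts ∧ 2 ≤ ts.toList.length ∧ ∀ u ∈ ts.toList, IsS u) ∨
    (∃ ts : SandTreeList B, t = .sand ts ∧ 2 ≤ ts.toList.length ∧ ∀ u ∈ ts.toList, IsC u) := by
  rcases h with h | h
  · cases h with
    | atom b => exact .inl ⟨b, rfl⟩
    | and hl h => exact .inr (.inl ⟨_, rfl, hl, SandTreeList.forall_isS_of_isSL h⟩)
  · cases h with
    | atom b => exact .inl ⟨b, rfl⟩
    | sand hl h => exact .inr (.inr ⟨_, rfl, hl, SandTreeList.forall_isC_of_isCL h⟩)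

/-- The `OR`-free normal form of a series-parallel structure is unique up to commutativity. -/
theorem SPRep.peq {t u : SandTree B} {E : Multiset α} (htA : IsA t) (huA : IsA u)
    (h₁ : SPRep r lab t E) (h₂ : SPRep r lab u E)
    (hr : ∀ e ∈ E, ∀ f ∈ E, r e f → ¬ r f e) : PEq t u := by
  induction hn : sizeOf t using Nat.strong_induction_on generalizing t u E with | _ n ih
  subst hn
  rcases htA.cases with ⟨b, rfl⟩ | ⟨ts, rfl, hlt, hts⟩ | ⟨ts, rfl, hlt, hts⟩
  · rcases huA.cases with ⟨c, rfl⟩ | ⟨us, rfl, hlu, hus⟩ | ⟨us, rfl, hlu, hus⟩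
    · cases h₁ with
      | atom e =>
        generalize hE : ({e} : Multiset α) = F at h₂
        cases h₂ with
        | atom f =>
          obtain rfl := Multiset.singleton_inj.1 hE
          exact .refl _
    · cases h₁ with
      | atom e =>
        cases h₂ with
        | and h =>
          obtain ⟨X, Y, hE, hX, hY, -⟩ := h.exists_add hlu
          exact absurd (singleton_eq_add hE) (by simp [hX, hY])
    · cases h₁ with
      | atom e =>
        cases h₂ with
        | sand h =>
          obtain ⟨X, Y, hE, hX, hY, -⟩ := h.exists_add hlu
          exact absurd (singleton_eq_add hE) (by simp [hX, hY])
  · have hsize : ∀ t ∈ ts.toList, sizeOf t < sizeOf (SandTree.and ts) := fun t ht => by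
      have := SandTreeList.sizeOf_lt_of_mem_toList ht
      simp only [SandTree.and.sizeOf_spec]
      omega
    cases h₁ with
    | and h₁ =>
      obtain ⟨X, Y, hE, hX, hY, hXY⟩ := h₁.exists_add hlt
      rcases huA.cases with ⟨c, rfl⟩ | ⟨us, rfl, hlu, hus⟩ | ⟨us, rfl, hlu, hus⟩
      · cases h₂ with
        | atom e => exact absurd (singleton_eq_add hE) (by simp [hX, hY])
      · cases h₂ with
        | and h₂ =>
          obtain ⟨l, hl, hp⟩ := h₁.exists_perm_forall₂_peq h₂ hts hus
            (fun t ht u hu X hX h₁ h₂ => ih _ (hsize t ht) (.inr (hts t ht)) (.inr (hus u hu)) h₁ h₂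
              (fun e he f hf => hr e (Multiset.mem_of_le hX he) f (Multiset.mem_of_le hX hf)) rfl)
          obtain ⟨us', rfl, h⟩ := SandTreeList.exists_peqL_of_forall₂ hl
          exact (PEq.andCongr h).trans (.andPerm hp)
      · cases h₂ with
        | sand h₂ =>
          obtain ⟨X', Y', hE', hX', hY', hXY'⟩ := h₂.exists_add hlu
          exact absurd hXY' (not_unrelated_of_precedes (hE.symm.trans hE') hX hY hX' hY' hXY)
  · have hsize : ∀ t ∈ ts.toList, sizeOf t < sizeOf (SandTree.sand ts) := fun t ht => by
      have := SandTreeList.sizeOf_lt_of_mem_toList ht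
      simp only [SandTree.sand.sizeOf_spec]
      omega
    cases h₁ with
    | sand h₁ =>
      obtain ⟨X, Y, hE, hX, hY, hXY⟩ := h₁.exists_add hlt
      rcases huA.cases with ⟨c, rfl⟩ | ⟨us, rfl, hlu, hus⟩ | ⟨us, rfl, hlu, hus⟩
      · cases h₂ with
        | atom e => exact absurd (singleton_eq_add hE) (by simp [hX, hY])
      · cases h₂ with
        | and h₂ =>
          obtain ⟨X', Y', hE', hX', hY', hXY'⟩ := h₂.exists_add hlu
          exact absurd hXY (not_unrelated_of_precedes (hE'.symm.trans hE) hX' hY' hX hY hXY')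
      · cases h₂ with
        | sand h₂ =>
          have hl := h₁.forall₂_peq h₂ hr hts hus
            (fun t ht u hu X hX h₁ h₂ => ih _ (hsize t ht) (.inl (hts t ht)) (.inl (hus u hu)) h₁ h₂
              (fun e he f hf => hr e (Multiset.mem_of_le hX he) f (Multiset.mem_of_le hX hf)) rfl)
          obtain ⟨us', hus', h⟩ := SandTreeList.exists_peqL_of_forall₂ hl
          obtain rfl : us' = us := SandTreeList.toList_injective hus'
          exact .sandCongr h

/-- Decompositions are transported along maps preserving and reflecting the relation. -/
theorem SPRep.map {r' : β → β → Prop} {lab' : β → B} {φ : α → β} {t : SandTree B}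
    {E : Multiset α} (h : SPRep r lab t E) (hlab : ∀ e, lab' (φ e) = lab e)
    (hφ : ∀ e ∈ E, ∀ f ∈ E, r' (φ e) (φ f) ↔ r e f) : SPRep r' lab' t (E.map φ) := by
  induction h using SPRep.rec
    (motive_2 := fun l E _ => (∀ e ∈ E, ∀ f ∈ E, r' (φ e) (φ f) ↔ r e f) →
      SPRepAnd r' lab' l (E.map φ))
    (motive_3 := fun l E _ => (∀ e ∈ E, ∀ f ∈ E, r' (φ e) (φ f) ↔ r e f) →
      SPRepSand r' lab' l (E.map φ)) with
  | atom e => simpa [hlab] using SPRep.atom (r := r') (lab := lab') (φ e)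
  | and _ ih => exact .and (ih hφ)
  | sand _ ih => exact .sand (ih hφ)
  | nil => exact .nil
  | cons _ _ hr ih ihs hφ =>
    rw [Multiset.map_add]
    refine .cons (ih fun e he f hf => hφ e (by simp [he]) f (by simp [hf]))
      (ihs fun e he f hf => hφ e (by simp [he]) f (by simp [hf])) ?_
    simp only [Unrelated, Multiset.mem_map, forall_exists_index, and_imp,
      forall_apply_eq_imp_iff₂]
    intro e he f hf
    rw [hφ e (by simp [he]) f (by simp [hf]), hφ f (by simp [hf]) e (by simp [he])]
    exact hr e he f hf
  | empty => exact .empty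
  | prepend _ _ hr ih ihs hφ =>
    rw [Multiset.map_add]
    refine .prepend (ih fun e he f hf => hφ e (by simp [he]) f (by simp [hf]))
      (ihs fun e he f hf => hφ e (by simp [he]) f (by simp [hf])) ?_
    simp only [Precedes, Multiset.mem_map, forall_exists_index, and_imp,
      forall_apply_eq_imp_iff₂]
    intro e he f hf
    rw [hφ e (by simp [he]) f (by simp [hf])]
    exact hr e he f hf

theorem SPRepAnd.map {r' : β → β → Prop} {lab' : β → B} {φ : α → β} {l : List (SandTree B)}
    {E : Multiset α} (h : SPRepAnd r lab l E) (hlab : ∀ e, lab' (φ e) = lab e)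
    (hφ : ∀ e ∈ E, ∀ f ∈ E, r' (φ e) (φ f) ↔ r e f) : SPRepAnd r' lab' l (E.map φ) := by
  induction l generalizing E with
  | nil => cases h; exact .nil
  | cons t ts ihs =>
    cases h with
    | cons h hs hr =>
      rw [Multiset.map_add]
      refine .cons (h.map hlab fun e he f hf => hφ e (by simp [he]) f (by simp [hf]))
        (ihs hs fun e he f hf => hφ e (by simp [he]) f (by simp [hf])) ?_
      simp only [Unrelated, Multiset.mem_map, forall_exists_index, and_imp,
        forall_apply_eq_imp_iff₂]
      intro e he f hf
      rw [hφ e (by simp [he]) f (by simp [hf]), hφ f (by simp [hf]) e (by simp [he])]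
      exact hr e he f hf

theorem SPRepSand.map {r' : β → β → Prop} {lab' : β → B} {φ : α → β} {l : List (SandTree B)}
    {E : Multiset α} (h : SPRepSand r lab l E) (hlab : ∀ e, lab' (φ e) = lab e)
    (hφ : ∀ e ∈ E, ∀ f ∈ E, r' (φ e) (φ f) ↔ r e f) : SPRepSand r' lab' l (E.map φ) := by
  induction l generalizing E with
  | nil => cases h; exact .empty
  | cons t ts ihs =>
    cases h with
    | prepend h hs hr =>
      rw [Multiset.map_add]
      refine .prepend (h.map hlab fun e he f hf => hφ e (by simp [he]) f (by simp [hf]))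
        (ihs hs fun e he f hf => hφ e (by simp [he]) f (by simp [hf])) ?_
      simp only [Precedes, Multiset.mem_map, forall_exists_index, and_imp,
        forall_apply_eq_imp_iff₂]
      intro e he f hf
      rw [hφ e (by simp [he]) f (by simp [hf])]
      exact hr e he f hf

end Decomposition

namespace SSG

variable {B : Type}

/-! ### Isomorphisms and compositions -/

@[simp] theorem seqEmbed_z (G G' : SSG B) : G.seqEmbed G' G.z = Sum.inr G'.s := by
  simp [seqEmbed]

theorem seqEmbed_of_ne (G G' : SSG B) {v : G.V} (h : v ≠ G.z) :
    G.seqEmbed G' v = Sum.inl ⟨v, h⟩ := by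
  simp [seqEmbed, h]

@[simp] theorem parEmbed_s (G G' : SSG B) : G.parEmbed G' G.s = Sum.inr G'.s := by
  simp [parEmbed]

@[simp] theorem parEmbed_z (G G' : SSG B) : G.parEmbed G' G.z = Sum.inr G'.z := by
  simp [parEmbed, G.ne.symm]

theorem parEmbed_of_ne (G G' : SSG B) {v : G.V} (hs : v ≠ G.s) (hz : v ≠ G.z) :
    G.parEmbed G' v = Sum.inl ⟨v, hs, hz⟩ := by
  simp [parEmbed, hs, hz]

theorem seqEmbed_injective (G G' : SSG B) : Function.Injective (G.seqEmbed G') := by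
  intro u v h
  by_cases hu : u = G.z <;> by_cases hv : v = G.z <;> simp_all [seqEmbed]

theorem parEmbed_injective (G G' : SSG B) : Function.Injective (G.parEmbed G') := by
  intro u v h
  have := G'.ne
  have := G'.ne.symm
  by_cases hu : u = G.s <;> by_cases hv : v = G.s <;> by_cases hu' : u = G.z <;>
    by_cases hv' : v = G.z <;> simp_all [parEmbed]

theorem seqEmbed_eq_inr_iff (G G' : SSG B) {u : G.V} {v : G'.V} :
    G.seqEmbed G' u = Sum.inr v ↔ u = G.z ∧ v = G'.s := by
  by_cases hu : u = G.z <;> simp [seqEmbed, hu, eq_comm]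

theorem parEmbed_eq_inr_iff (G G' : SSG B) {u : G.V} {v : G'.V} :
    G.parEmbed G' u = Sum.inr v ↔ (u = G.s ∧ v = G'.s) ∨ (u = G.z ∧ v = G'.z) := by
  have := G.ne
  by_cases hu : u = G.s <;> by_cases hu' : u = G.z <;> simp_all [parEmbed, eq_comm]

/-- The action of a map of vertices on labeled edges. -/
def mapEdge {V W : Type} (f : V → W) (e : V × B × V) : W × B × W := (f e.1, e.2.1, f e.2.2)

theorem map_mapEdge_mapEdge {U V W : Type} (g : V → W) (f : U → V) (E : Multiset (U × B × U)) :
    (E.map (mapEdge f)).map (mapEdge g) = E.map (mapEdge (g ∘ f)) := by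
  rw [Multiset.map_map]
  rfl

theorem map_mapEdge_id {V : Type} (E : Multiset (V × B × V)) : E.map (mapEdge id) = E := by
  conv_rhs => rw [← Multiset.map_id E]
  rfl

theorem Iso.refl (G : SSG B) : G.Iso G := ⟨Equiv.refl _, map_mapEdge_id _, rfl, rfl⟩

theorem Iso.symm {G H : SSG B} : G.Iso H → H.Iso G := by
  rintro ⟨f, hE, hs, hz⟩
  refine ⟨f.symm, ?_, by simp [← hs], by simp [← hz]⟩
  rw [← hE]
  refine (map_mapEdge_mapEdge f.symm f G.E).trans ?_
  simp [map_mapEdge_id]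

theorem Iso.trans {G H K : SSG B} : G.Iso H → H.Iso K → G.Iso K := by
  rintro ⟨f, hE, hs, hz⟩ ⟨g, hE', hs', hz'⟩
  refine ⟨f.trans g, ?_, by simp [hs, hs'], by simp [hz, hz']⟩
  rw [← hE', ← hE]
  exact (map_mapEdge_mapEdge g f G.E).symm

/-- `H` is a sequential composition of its subgraphs `G` and `G'`. -/
structure SeqDec (G G' H : SSG B) (i : G.V → H.V) (j : G'.V → H.V) : Prop where
  inj : Function.Injective i
  inj' : Function.Injective j
  eq_iff : ∀ u v, i u = j v ↔ u = G.z ∧ v = G'.s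
  surj : ∀ w, (∃ u, i u = w) ∨ ∃ v, j v = w
  E_eq : H.E = G.E.map (mapEdge i) + G'.E.map (mapEdge j)
  s_eq : i G.s = H.s
  z_eq : j G'.z = H.z

/-- `H` is a parallel composition of its subgraphs `G` and `G'`. -/
structure ParDec (G G' H : SSG B) (i : G.V → H.V) (j : G'.V → H.V) : Prop where
  inj : Function.Injective i
  inj' : Function.Injective j
  eq_iff : ∀ u v, i u = j v ↔ (u = G.s ∧ v = G'.s) ∨ (u = G.z ∧ v = G'.z)
  surj : ∀ w, (∃ u, i u = w) ∨ ∃ v, j v = w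
  E_eq : H.E = G.E.map (mapEdge i) + G'.E.map (mapEdge j)
  s_eq : j G'.s = H.s
  z_eq : j G'.z = H.z

/-- The inclusion of the first graph into a sequential composition. -/
def seqInl (G G' : SSG B) : G.V → (G.seq G').V := G.seqEmbed G'

/-- The inclusion of the second graph into a sequential composition. -/
def seqInr (G G' : SSG B) : G'.V → (G.seq G').V := Sum.inr

/-- The inclusion of the first graph into a parallel composition. -/
def parInl (G G' : SSG B) : G.V → (G.par G').V := G.parEmbed G'

/-- The inclusion of the second graph into a parallel composition. -/
def parInr (G G' : SSG B) : G'.V → (G.par G').V := Sum.inr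

theorem seqDec_seq (G G' : SSG B) :
    SeqDec G G' (G.seq G') (G.seqInl G') (G.seqInr G') where
  inj := seqEmbed_injective G G'
  inj' := Sum.inr_injective
  eq_iff _ _ := seqEmbed_eq_inr_iff G G'
  surj
    | .inl u => .inl ⟨u.1, seqEmbed_of_ne G G' u.2⟩
    | .inr v => .inr ⟨v, rfl⟩
  E_eq := rfl
  s_eq := seqEmbed_of_ne G G' G.ne
  z_eq := rfl

theorem parDec_par (G G' : SSG B) :
    ParDec G G' (G.par G') (G.parInl G') (G.parInr G') where
  inj := parEmbed_injective G G'
  inj' := Sum.inr_injective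
  eq_iff _ _ := parEmbed_eq_inr_iff G G'
  surj
    | .inl u => .inl ⟨u.1, parEmbed_of_ne G G' u.2.1 u.2.2⟩
    | .inr v => .inr ⟨v, rfl⟩
  E_eq := rfl
  s_eq := rfl
  z_eq := rfl

/-- Descent of a compatible pair of maps along a jointly surjective pair of injections. -/
theorem exists_desc {U V W X : Type} {i : U → W} {j : V → W} (hi : Function.Injective i)
    (hj : Function.Injective j) (hs : ∀ w, (∃ u, i u = w) ∨ ∃ v, j v = w)
    {i' : U → X} {j' : V → X} (hc : ∀ u v, i u = j v → i' u = j' v) :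
    ∃ k : W → X, k ∘ i = i' ∧ k ∘ j = j' := by
  have : ∀ w, ∃ x, (∀ u, i u = w → i' u = x) ∧ ∀ v, j v = w → j' v = x := by
    intro w
    rcases hs w with ⟨u, rfl⟩ | ⟨v, rfl⟩
    · exact ⟨i' u, fun u' h => by rw [hi h], fun v h => (hc u v h.symm).symm⟩
    · exact ⟨j' v, fun u h => hc u v h, fun v' h => by rw [hj h]⟩
  choose k hk hk' using this
  exact ⟨k, funext fun u => (hk _ u rfl).symm, funext fun v => (hk' _ v rfl).symm⟩

theorem bijective_of_comp {U V W X : Type} {i : U → W} {j : V → W}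
    (hs : ∀ w, (∃ u, i u = w) ∨ ∃ v, j v = w) {k : W → X}
    (hi' : Function.Injective (k ∘ i)) (hj' : Function.Injective (k ∘ j))
    (hs' : ∀ x, (∃ u, (k ∘ i) u = x) ∨ ∃ v, (k ∘ j) v = x)
    (hc : ∀ u v, (k ∘ i) u = (k ∘ j) v → i u = j v) : Function.Bijective k := by
  constructor
  · intro w w' h
    rcases hs w with ⟨u, rfl⟩ | ⟨v, rfl⟩ <;> rcases hs w' with ⟨u', rfl⟩ | ⟨v', rfl⟩
    · rw [hi' h]
    · exact hc _ _ h
    · exact (hc _ _ h.symm).symm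
    · rw [hj' h]
  · intro x
    rcases hs' x with ⟨u, rfl⟩ | ⟨v, rfl⟩
    · exact ⟨i u, rfl⟩
    · exact ⟨j v, rfl⟩

theorem SeqDec.iso {G G' H K : SSG B} {i : G.V → H.V} {j : G'.V → H.V} {i' : G.V → K.V}
    {j' : G'.V → K.V} (h : SeqDec G G' H i j) (h' : SeqDec G G' K i' j') : H.Iso K := by
  have hc : ∀ u v, i u = j v ↔ i' u = j' v := fun u v => by rw [h.eq_iff, h'.eq_iff]
  obtain ⟨k, rfl, rfl⟩ := exists_desc h.inj h.inj' h.surj fun u v => (hc u v).1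
  refine ⟨Equiv.ofBijective k (bijective_of_comp h.surj h'.inj h'.inj' h'.surj
    fun u v => (hc u v).2), ?_, ?_, ?_⟩
  · change H.E.map (mapEdge k) = K.E
    rw [h.E_eq, Multiset.map_add, map_mapEdge_mapEdge, map_mapEdge_mapEdge, h'.E_eq]
  · rw [← h.s_eq, ← h'.s_eq]; rfl
  · rw [← h.z_eq, ← h'.z_eq]; rfl

theorem ParDec.iso {G G' H K : SSG B} {i : G.V → H.V} {j : G'.V → H.V} {i' : G.V → K.V}
    {j' : G'.V → K.V} (h : ParDec G G' H i j) (h' : ParDec G G' K i' j') : H.Iso K := by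
  have hc : ∀ u v, i u = j v ↔ i' u = j' v := fun u v => by rw [h.eq_iff, h'.eq_iff]
  obtain ⟨k, rfl, rfl⟩ := exists_desc h.inj h.inj' h.surj fun u v => (hc u v).1
  refine ⟨Equiv.ofBijective k (bijective_of_comp h.surj h'.inj h'.inj' h'.surj
    fun u v => (hc u v).2), ?_, ?_, ?_⟩
  · change H.E.map (mapEdge k) = K.E
    rw [h.E_eq, Multiset.map_add, map_mapEdge_mapEdge, map_mapEdge_mapEdge, h'.E_eq]
  · rw [← h.s_eq, ← h'.s_eq]; rfl
  · rw [← h.z_eq, ← h'.z_eq]; rfl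

theorem ParDec.symm {G G' H : SSG B} {i : G.V → H.V} {j : G'.V → H.V}
    (h : ParDec G G' H i j) : ParDec G' G H j i where
  inj := h.inj'
  inj' := h.inj
  eq_iff u v := by rw [eq_comm, h.eq_iff]; tauto
  surj w := (h.surj w).symm
  E_eq := by rw [h.E_eq, add_comm]
  s_eq := by rw [← h.s_eq, h.eq_iff]; simp
  z_eq := by rw [← h.z_eq, h.eq_iff]; simp

theorem par_comm_iso (G G' : SSG B) : (G.par G').Iso (G'.par G) :=
  (parDec_par G G').iso (parDec_par G' G).symm

theorem Iso.seq {G G' H H' : SSG B} : G.Iso H → G'.Iso H' → (G.seq G').Iso (H.seq H') := by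
  rintro ⟨f, hE, hs, hz⟩ ⟨g, hE', hs', hz'⟩
  have d := seqDec_seq H H'
  refine (seqDec_seq G G').iso (i' := H.seqInl H' ∘ f) (j' := H.seqInr H' ∘ g)
    ⟨d.inj.comp f.injective, d.inj'.comp g.injective, fun u v => ?_, fun w => ?_, ?_, ?_, ?_⟩
  · rw [Function.comp_apply, Function.comp_apply, d.eq_iff, ← hz, ← hs', f.injective.eq_iff,
      g.injective.eq_iff]
  · rcases d.surj w with ⟨u, rfl⟩ | ⟨v, rfl⟩
    · exact .inl ⟨f.symm u, by simp⟩
    · exact .inr ⟨g.symm v, by simp⟩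
  · rw [d.E_eq, ← hE, ← hE', ← map_mapEdge_mapEdge, ← map_mapEdge_mapEdge]
    rfl
  · rw [← d.s_eq, ← hs]; rfl
  · rw [← d.z_eq, ← hz']; rfl

theorem Iso.par {G G' H H' : SSG B} : G.Iso H → G'.Iso H' → (G.par G').Iso (H.par H') := by
  rintro ⟨f, hE, hs, hz⟩ ⟨g, hE', hs', hz'⟩
  have d := parDec_par H H'
  refine (parDec_par G G').iso (i' := H.parInl H' ∘ f) (j' := H.parInr H' ∘ g)
    ⟨d.inj.comp f.injective, d.inj'.comp g.injective, fun u v => ?_, fun w => ?_, ?_, ?_, ?_⟩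
  · rw [Function.comp_apply, Function.comp_apply, d.eq_iff, ← hz, ← hs', ← hz', ← hs,
      f.injective.eq_iff, g.injective.eq_iff, f.injective.eq_iff, g.injective.eq_iff]
  · rcases d.surj w with ⟨u, rfl⟩ | ⟨v, rfl⟩
    · exact .inl ⟨f.symm u, by simp⟩
    · exact .inr ⟨g.symm v, by simp⟩
  · rw [d.E_eq, ← hE, ← hE', ← map_mapEdge_mapEdge, ← map_mapEdge_mapEdge]
    rfl
  · rw [← d.s_eq, ← hs']; rfl
  · rw [← d.z_eq, ← hz']; rfl

theorem seq_assoc_iso (G₁ G₂ G₃ : SSG B) :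
    ((G₁.seq G₂).seq G₃).Iso (G₁.seq (G₂.seq G₃)) := by
  have c := seqDec_seq G₁ G₂
  have d := seqDec_seq G₂ G₃
  have d' := seqDec_seq G₁ (G₂.seq G₃)
  obtain ⟨k, hk, hk'⟩ := exists_desc c.inj c.inj' c.surj
    (i' := G₁.seqInl (G₂.seq G₃)) (j' := G₁.seqInr (G₂.seq G₃) ∘ G₂.seqInl G₃) fun u v h => by
      obtain ⟨rfl, rfl⟩ := (c.eq_iff u v).1 h
      exact (d'.eq_iff _ _).2 ⟨rfl, d.s_eq⟩
  have hk₁ := congrFun hk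
  have hk₂ := congrFun hk'
  simp only [Function.comp_apply] at hk₁ hk₂
  have hc : ∀ u v, k (G₁.seqInl G₂ u) = k (G₁.seqInr G₂ v) → G₁.seqInl G₂ u = G₁.seqInr G₂ v := by
    intro u v h
    rw [hk₁, hk₂, d'.eq_iff, ← d.s_eq, d.inj.eq_iff] at h
    exact (c.eq_iff _ _).2 h
  refine (seqDec_seq _ G₃).iso (i' := k) (j' := G₁.seqInr (G₂.seq G₃) ∘ G₂.seqInr G₃)
    ⟨?_, d'.inj'.comp d.inj', ?_, ?_, ?_, ?_, ?_⟩
  · intro x y h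
    rcases c.surj x with ⟨u, rfl⟩ | ⟨u, rfl⟩ <;> rcases c.surj y with ⟨v, rfl⟩ | ⟨v, rfl⟩
    · rw [hk₁, hk₁] at h
      rw [d'.inj h]
    · exact hc _ _ h
    · exact (hc _ _ h.symm).symm
    · rw [hk₂, hk₂] at h
      rw [d.inj (d'.inj' h)]
  · intro x v
    rcases c.surj x with ⟨u, rfl⟩ | ⟨u, rfl⟩
    · rw [hk₁, Function.comp_apply, d'.eq_iff, ← d.s_eq, eq_comm (b := G₂.seqInl G₃ G₂.s),
        d.eq_iff, ← c.z_eq, c.eq_iff, eq_comm (a := G₂.z), and_assoc]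
    · rw [hk₂, Function.comp_apply, d'.inj'.eq_iff, d.eq_iff, ← c.z_eq,
        c.inj'.eq_iff]
  · intro w
    rcases d'.surj w with ⟨u, rfl⟩ | ⟨w, rfl⟩
    · exact .inl ⟨_, hk₁ u⟩
    · rcases d.surj w with ⟨u, rfl⟩ | ⟨v, rfl⟩
      · exact .inl ⟨_, hk₂ u⟩
      · exact .inr ⟨v, rfl⟩
  · rw [d'.E_eq, d.E_eq, c.E_eq, Multiset.map_add, Multiset.map_add, map_mapEdge_mapEdge,
      map_mapEdge_mapEdge, map_mapEdge_mapEdge, map_mapEdge_mapEdge, hk, hk', add_assoc]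
  · rw [← d'.s_eq, ← c.s_eq, hk₁]
  · rw [← d'.z_eq, ← d.z_eq]; rfl

theorem par_assoc_iso (G₁ G₂ G₃ : SSG B) :
    ((G₁.par G₂).par G₃).Iso (G₁.par (G₂.par G₃)) := by
  have c := parDec_par G₁ G₂
  have d := parDec_par G₂ G₃
  have d' := parDec_par G₁ (G₂.par G₃)
  have hs : G₂.parInl G₃ G₂.s = (G₂.par G₃).s := d.symm.s_eq
  have hz : G₂.parInl G₃ G₂.z = (G₂.par G₃).z := d.symm.z_eq
  obtain ⟨k, hk, hk'⟩ := exists_desc c.inj c.inj' c.surj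
    (i' := G₁.parInl (G₂.par G₃)) (j' := G₁.parInr (G₂.par G₃) ∘ G₂.parInl G₃) fun u v h => by
      rw [Function.comp_apply, d'.eq_iff, ← hs, ← hz, d.inj.eq_iff, d.inj.eq_iff]
      exact (c.eq_iff u v).1 h
  have hk₁ := congrFun hk
  have hk₂ := congrFun hk'
  simp only [Function.comp_apply] at hk₁ hk₂
  have hc : ∀ u v, k (G₁.parInl G₂ u) = k (G₁.parInr G₂ v) → G₁.parInl G₂ u = G₁.parInr G₂ v := by
    intro u v h
    rw [hk₁, hk₂, d'.eq_iff, ← hs, ← hz, d.inj.eq_iff, d.inj.eq_iff] at h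
    exact (c.eq_iff _ _).2 h
  refine (parDec_par _ G₃).iso (i' := k) (j' := G₁.parInr (G₂.par G₃) ∘ G₂.parInr G₃)
    ⟨?_, d'.inj'.comp d.inj', ?_, ?_, ?_, ?_, ?_⟩
  · intro x y h
    rcases c.surj x with ⟨u, rfl⟩ | ⟨u, rfl⟩ <;> rcases c.surj y with ⟨v, rfl⟩ | ⟨v, rfl⟩
    · rw [hk₁, hk₁] at h
      rw [d'.inj h]
    · exact hc _ _ h
    · exact (hc _ _ h.symm).symm
    · rw [hk₂, hk₂] at h
      rw [d.inj (d'.inj' h)]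
  · intro x v
    rcases c.surj x with ⟨u, rfl⟩ | ⟨u, rfl⟩
    · rw [hk₁, Function.comp_apply, d'.eq_iff, ← d.s_eq, ← d.z_eq, d.inj'.eq_iff, d.inj'.eq_iff,
        ← c.symm.s_eq, ← c.symm.z_eq, c.inj.eq_iff, c.inj.eq_iff]
    · rw [hk₂, Function.comp_apply, d'.inj'.eq_iff, d.eq_iff, ← c.s_eq,
        ← c.z_eq, c.inj'.eq_iff, c.inj'.eq_iff]
  · intro w
    rcases d'.surj w with ⟨u, rfl⟩ | ⟨w, rfl⟩
    · exact .inl ⟨_, hk₁ u⟩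
    · rcases d.surj w with ⟨u, rfl⟩ | ⟨v, rfl⟩
      · exact .inl ⟨_, hk₂ u⟩
      · exact .inr ⟨v, rfl⟩
  · rw [d'.E_eq, d.E_eq, c.E_eq, Multiset.map_add, Multiset.map_add, map_mapEdge_mapEdge,
      map_mapEdge_mapEdge, map_mapEdge_mapEdge, map_mapEdge_mapEdge, hk, hk', add_assoc]
  · rw [← d'.s_eq, ← d.s_eq]; rfl
  · rw [← d'.z_eq, ← d.z_eq]; rfl

theorem par_left_comm_iso (G₁ G₂ G₃ : SSG B) :
    (G₁.par (G₂.par G₃)).Iso (G₂.par (G₁.par G₃)) :=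
  (par_assoc_iso G₁ G₂ G₃).symm.trans
    (((par_comm_iso G₁ G₂).par (Iso.refl G₃)).trans (par_assoc_iso G₂ G₁ G₃))

/-! ### Reachability -/

/-- `v` is reachable from `u` by a directed path. -/
def Reach (G : SSG B) : G.V → G.V → Prop := Relation.ReflTransGen G.Adj

/-- The edge `f` is reachable from the edge `e`. -/
def edgeRel (G : SSG B) (e f : G.V × B × G.V) : Prop := G.Reach e.2.2 f.1

theorem reach_edge {G : SSG B} {e : G.V × B × G.V} (he : e ∈ G.E) : G.Reach e.1 e.2.2 :=
  .single ⟨e.2.1, he⟩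

theorem Reach.map {G H : SSG B} {p : G.V → H.V} (hp : ∀ e ∈ G.E, H.Reach (p e.1) (p e.2.2))
    {u v : G.V} (h : G.Reach u v) : H.Reach (p u) (p v) :=
  Relation.ReflTransGen.lift' p (fun _ _ ⟨_, hb⟩ => hp _ hb) _ _ h

theorem Reach.map_of_mem {G H : SSG B} {p : G.V → H.V} (hp : ∀ e ∈ G.E, mapEdge p e ∈ H.E)
    {u v : G.V} (h : G.Reach u v) : H.Reach (p u) (p v) :=
  h.map fun e he => reach_edge (hp e he)

/-- Acyclic graphs in which every vertex lies on a path from the source to the sink. -/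
structure IsFlow (G : SSG B) : Prop where
  reach_s : ∀ v, G.Reach G.s v
  reach_z : ∀ v, G.Reach v G.z
  not_reach : ∀ e ∈ G.E, ¬ G.Reach e.2.2 e.1

theorem IsFlow.target_ne_s {G : SSG B} (hG : G.IsFlow) {e : G.V × B × G.V} (he : e ∈ G.E) :
    e.2.2 ≠ G.s := fun h => hG.not_reach e he (h ▸ hG.reach_s _)

theorem IsFlow.not_reach_z {G : SSG B} (hG : G.IsFlow) {e : G.V × B × G.V} (he : e ∈ G.E) :
    ¬ G.Reach G.z e.1 := fun h => hG.not_reach e he ((hG.reach_z _).trans h)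

theorem IsFlow.edgeRel_asymm {G : SSG B} (hG : G.IsFlow) :
    ∀ e ∈ G.E, ∀ f ∈ G.E, G.edgeRel e f → ¬ G.edgeRel f e :=
  fun e he _ hf h h' => hG.not_reach e he ((h.trans (reach_edge hf)).trans h')

theorem isFlow_single (b : B) : (single b).IsFlow := by
  have h : (single b).Reach false true := .single ⟨b, Multiset.mem_singleton_self _⟩
  refine ⟨fun v => ?_, fun v => ?_, fun e he hr => ?_⟩
  · cases v
    exacts [.refl, h]
  · cases v
    exacts [h, .refl]
  · obtain rfl : e = (false, b, true) := Multiset.mem_singleton.1 he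
    rcases Relation.ReflTransGen.cases_head hr with h | ⟨c, ⟨b', hb⟩, -⟩
    · exact Bool.false_ne_true h.symm
    · have := congrArg Prod.fst (Multiset.mem_singleton.1 hb)
      exact Bool.false_ne_true this.symm

theorem Iso.isFlow_and_embedding {G H : SSG B} (h : G.Iso H) (hG : G.IsFlow) :
    H.IsFlow ∧ ∃ i : G.V → H.V, (∀ u v, H.Reach (i u) (i v) ↔ G.Reach u v) ∧
      H.E = G.E.map (mapEdge i) := by
  obtain ⟨f, hE, hs, hz⟩ := h
  have hE' : H.E.map (mapEdge f.symm) = G.E := by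
    rw [← hE]
    refine (map_mapEdge_mapEdge f.symm f G.E).trans ?_
    simp [map_mapEdge_id]
  have hf : ∀ u v, H.Reach (f u) (f v) ↔ G.Reach u v := by
    refine fun u v => ⟨fun h => ?_, fun h => h.map_of_mem fun e he => ?_⟩
    · simpa using h.map_of_mem (H := G) (p := f.symm)
        fun e he => hE' ▸ Multiset.mem_map_of_mem _ he
    · exact hE ▸ Multiset.mem_map_of_mem _ he
  refine ⟨⟨fun v => ?_, fun v => ?_, fun e he => ?_⟩, f, hf, hE.symm⟩
  · rw [← hs, ← f.apply_symm_apply v, hf]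
    exact hG.reach_s _
  · rw [← hz, ← f.apply_symm_apply v, hf]
    exact hG.reach_z _
  · rw [← hE] at he
    obtain ⟨e₀, he₀, rfl⟩ := Multiset.mem_map.1 he
    rw [hf]
    exact hG.not_reach e₀ he₀

section

variable {G G' H : SSG B} {i : G.V → H.V} {j : G'.V → H.V}

theorem not_reach_of_map_add_map (hE : H.E = G.E.map (mapEdge i) + G'.E.map (mapEdge j))
    (hi : ∀ u v, H.Reach (i u) (i v) ↔ G.Reach u v)
    (hj : ∀ u v, H.Reach (j u) (j v) ↔ G'.Reach u v) (hG : G.IsFlow) (hG' : G'.IsFlow) :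
    ∀ e ∈ H.E, ¬ H.Reach e.2.2 e.1 := by
  intro e he
  rw [hE, Multiset.mem_add, Multiset.mem_map, Multiset.mem_map] at he
  rcases he with ⟨e, he, rfl⟩ | ⟨e, he, rfl⟩
  · exact fun h => hG.not_reach e he ((hi _ _).1 h)
  · exact fun h => hG'.not_reach e he ((hj _ _).1 h)

theorem reach_comp {K : SSG B} {p : H.V → K.V}
    (hE : H.E = G.E.map (mapEdge i) + G'.E.map (mapEdge j))
    (hi : ∀ e ∈ G.E, K.Reach (p (i e.1)) (p (i e.2.2)))
    (hj : ∀ e ∈ G'.E, K.Reach (p (j e.1)) (p (j e.2.2))) {u v : H.V} (h : H.Reach u v) :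
    K.Reach (p u) (p v) := by
  refine h.map fun e he => ?_
  rw [hE, Multiset.mem_add, Multiset.mem_map, Multiset.mem_map] at he
  rcases he with ⟨e, he, rfl⟩ | ⟨e, he, rfl⟩
  exacts [hi e he, hj e he]

theorem reach_left (hE : H.E = G.E.map (mapEdge i) + G'.E.map (mapEdge j)) {u v : G.V}
    (h : G.Reach u v) : H.Reach (i u) (i v) :=
  h.map_of_mem fun _ he => hE ▸ Multiset.mem_add.2 (.inl (Multiset.mem_map_of_mem _ he))

theorem reach_right (hE : H.E = G.E.map (mapEdge i) + G'.E.map (mapEdge j)) {u v : G'.V}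
    (h : G'.Reach u v) : H.Reach (j u) (j v) :=
  h.map_of_mem fun _ he => hE ▸ Multiset.mem_add.2 (.inr (Multiset.mem_map_of_mem _ he))

theorem SeqDec.reach_left_iff (d : SeqDec G G' H i j) (u v : G.V) :
    H.Reach (i u) (i v) ↔ G.Reach u v := by
  refine ⟨fun h => ?_, reach_left d.E_eq⟩
  obtain ⟨p, hp, hp'⟩ := exists_desc d.inj d.inj' d.surj (i' := id) (j' := fun _ => G.z)
    fun u v h => ((d.eq_iff u v).1 h).1
  have hp := congrFun hp
  have hp' := congrFun hp'
  simp only [Function.comp_apply, id] at hp hp'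
  have := reach_comp (p := p) d.E_eq (fun _ he => by simpa [hp] using reach_edge he)
    (fun e _ => by rw [hp', hp']; exact .refl) h
  rwa [hp, hp] at this

theorem SeqDec.reach_right_iff (d : SeqDec G G' H i j) (u v : G'.V) :
    H.Reach (j u) (j v) ↔ G'.Reach u v := by
  refine ⟨fun h => ?_, reach_right d.E_eq⟩
  obtain ⟨p, hp, hp'⟩ := exists_desc d.inj d.inj' d.surj (i' := fun _ => G'.s) (j' := id)
    fun u v h => ((d.eq_iff u v).1 h).2.symm
  have hp := congrFun hp
  have hp' := congrFun hp'
  simp only [Function.comp_apply, id] at hp hp'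
  have := reach_comp (p := p) d.E_eq (fun e _ => by rw [hp, hp]; exact .refl)
    (fun _ he => by simpa [hp'] using reach_edge he) h
  rwa [hp', hp'] at this

theorem SeqDec.reach_across (d : SeqDec G G' H i j) (hG : G.IsFlow) (hG' : G'.IsFlow) (u : G.V)
    (v : G'.V) : H.Reach (i u) (j v) := by
  have h : i G.z = j G'.s := (d.eq_iff _ _).2 ⟨rfl, rfl⟩
  have h₁ := reach_left d.E_eq (hG.reach_z u)
  have h₂ := reach_right d.E_eq (hG'.reach_s v)
  exact (h ▸ h₁).trans h₂

theorem SeqDec.isFlow (d : SeqDec G G' H i j) (hG : G.IsFlow) (hG' : G'.IsFlow) : H.IsFlow where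
  reach_s w := by
    rw [← d.s_eq]
    rcases d.surj w with ⟨u, rfl⟩ | ⟨v, rfl⟩
    · exact reach_left d.E_eq (hG.reach_s u)
    · exact d.reach_across hG hG' _ v
  reach_z w := by
    rw [← d.z_eq]
    rcases d.surj w with ⟨u, rfl⟩ | ⟨v, rfl⟩
    · exact d.reach_across hG hG' u _
    · exact reach_right d.E_eq (hG'.reach_z v)
  not_reach := not_reach_of_map_add_map d.E_eq d.reach_left_iff d.reach_right_iff hG hG'

theorem SeqDec.precedes (d : SeqDec G G' H i j) (hG : G.IsFlow) (hG' : G'.IsFlow) :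
    Precedes H.edgeRel (G.E.map (mapEdge i)) (G'.E.map (mapEdge j)) := by
  intro e he f hf
  obtain ⟨e, -, rfl⟩ := Multiset.mem_map.1 he
  obtain ⟨f, -, rfl⟩ := Multiset.mem_map.1 hf
  exact d.reach_across hG hG' _ _

/-- A parallel composition of flows retracts onto its first component, such that all edges of
the other component are contracted or end in the sink. -/
theorem ParDec.exists_retraction (d : ParDec G G' H i j) (hG : G.IsFlow) (hG' : G'.IsFlow) :
    ∃ p : H.V → G.V, (∀ u, p (i u) = u) ∧ (∀ v, v ≠ G'.s → p (j v) = G.z) ∧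
      ∀ u v, H.Reach u v → G.Reach (p u) (p v) := by
  classical
  obtain ⟨p, hp, hp'⟩ := exists_desc d.inj d.inj' d.surj (i' := id)
    (j' := fun v => if v = G'.s then G.s else G.z) fun u v h => by
      rcases (d.eq_iff u v).1 h with ⟨rfl, rfl⟩ | ⟨rfl, rfl⟩
      · simp
      · simp [G'.ne.symm]
  have hp := congrFun hp
  have hp' := congrFun hp'
  simp only [Function.comp_apply, id] at hp hp'
  have hp'' : ∀ v, v ≠ G'.s → p (j v) = G.z := fun v hv => by rw [hp', if_neg hv]
  refine ⟨p, hp, hp'', fun u v => reach_comp d.E_eq (fun _ he => by simpa [hp] using reach_edge he)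
    fun e he => ?_⟩
  rw [hp'' _ (hG'.target_ne_s he)]
  exact hG.reach_z _

theorem ParDec.reach_left_iff (d : ParDec G G' H i j) (hG : G.IsFlow) (hG' : G'.IsFlow)
    (u v : G.V) : H.Reach (i u) (i v) ↔ G.Reach u v := by
  refine ⟨fun h => ?_, reach_left d.E_eq⟩
  obtain ⟨p, hp, -, h'⟩ := d.exists_retraction hG hG'
  simpa [hp] using h' _ _ h

theorem ParDec.not_reach_across (d : ParDec G G' H i j) (hG : G.IsFlow) (hG' : G'.IsFlow)
    {e : G.V × B × G.V} (he : e ∈ G.E) {f : G'.V × B × G'.V} (hf : f ∈ G'.E) :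
    ¬ H.Reach (j f.2.2) (i e.1) := by
  intro h
  obtain ⟨p, hp, hp', h'⟩ := d.exists_retraction hG hG'
  have := h' _ _ h
  rw [hp, hp' _ (hG'.target_ne_s hf)] at this
  exact hG.not_reach_z he this

theorem ParDec.isFlow (d : ParDec G G' H i j) (hG : G.IsFlow) (hG' : G'.IsFlow) : H.IsFlow where
  reach_s w := by
    rcases d.surj w with ⟨u, rfl⟩ | ⟨v, rfl⟩
    · rw [← d.symm.s_eq]
      exact reach_left d.E_eq (hG.reach_s u)
    · rw [← d.s_eq]
      exact reach_right d.E_eq (hG'.reach_s v)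
  reach_z w := by
    rcases d.surj w with ⟨u, rfl⟩ | ⟨v, rfl⟩
    · rw [← d.symm.z_eq]
      exact reach_left d.E_eq (hG.reach_z u)
    · rw [← d.z_eq]
      exact reach_right d.E_eq (hG'.reach_z v)
  not_reach := not_reach_of_map_add_map d.E_eq (d.reach_left_iff hG hG')
    (d.symm.reach_left_iff hG' hG) hG hG'

theorem ParDec.unrelated (d : ParDec G G' H i j) (hG : G.IsFlow) (hG' : G'.IsFlow) :
    Unrelated H.edgeRel (G.E.map (mapEdge i)) (G'.E.map (mapEdge j)) := by
  intro e he f hf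
  obtain ⟨e₀, he₀, rfl⟩ := Multiset.mem_map.1 he
  obtain ⟨f₀, hf₀, rfl⟩ := Multiset.mem_map.1 hf
  exact ⟨d.symm.not_reach_across hG' hG hf₀ he₀, d.not_reach_across hG hG' he₀ hf₀⟩

end

end SSG

/-! ### The SP semantics of `OR`-free normal forms -/

section Semantics

variable {B : Type}

mutual
theorem mem_sem_of_iso : ∀ (t : SandTree B) {G H : SSG B}, G.Iso H → G ∈ sem t → H ∈ sem t
  | .atom _, _, _, h, hG => hG.trans h
  | .or ts, _, _, h, hG => mem_semOr_of_iso ts h hG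
  | .and ts, _, _, h, hG => mem_semAnd_of_iso ts h hG
  | .sand ts, _, _, h, hG => mem_semSand_of_iso ts h hG
theorem mem_semOr_of_iso :
    ∀ (ts : SandTreeList B) {G H : SSG B}, G.Iso H → G ∈ semOr ts → H ∈ semOr ts
  | .single t, _, _, h, hG => mem_sem_of_iso t h hG
  | .cons t ts, _, _, h, hG => hG.imp (mem_sem_of_iso t h) (mem_semOr_of_iso ts h)
theorem mem_semAnd_of_iso :
    ∀ (ts : SandTreeList B) {G H : SSG B}, G.Iso H → G ∈ semAnd ts → H ∈ semAnd ts
  | .single t, _, _, h, hG => mem_sem_of_iso t h hG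
  | .cons _ _, _, _, h, ⟨G₁, h₁, G₂, h₂, hG⟩ => ⟨G₁, h₁, G₂, h₂, hG.trans h⟩
theorem mem_semSand_of_iso :
    ∀ (ts : SandTreeList B) {G H : SSG B}, G.Iso H → G ∈ semSand ts → H ∈ semSand ts
  | .single t, _, _, h, hG => mem_sem_of_iso t h hG
  | .cons _ _, _, _, h, ⟨G₁, h₁, G₂, h₂, hG⟩ => ⟨G₁, h₁, G₂, h₂, hG.trans h⟩
end

mutual
theorem sem_nonempty : ∀ t : SandTree B, (sem t).Nonempty
  | .atom b => ⟨_, SSG.Iso.refl (SSG.single b)⟩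
  | .or ts => semOr_nonempty ts
  | .and ts => semAnd_nonempty ts
  | .sand ts => semSand_nonempty ts
theorem semOr_nonempty : ∀ ts : SandTreeList B, (semOr ts).Nonempty
  | .single t => sem_nonempty t
  | .cons t _ => (sem_nonempty t).inl
theorem semAnd_nonempty : ∀ ts : SandTreeList B, (semAnd ts).Nonempty
  | .single t => sem_nonempty t
  | .cons t ts =>
    have ⟨G, hG⟩ := sem_nonempty t
    have ⟨H, hH⟩ := semAnd_nonempty ts
    ⟨G.par H, G, hG, H, hH, .refl _⟩
theorem semSand_nonempty : ∀ ts : SandTreeList B, (semSand ts).Nonempty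
  | .single t => sem_nonempty t
  | .cons t ts =>
    have ⟨G, hG⟩ := sem_nonempty t
    have ⟨H, hH⟩ := semSand_nonempty ts
    ⟨G.seq H, G, hG, H, hH, .refl _⟩
end

theorem mem_semOr_iff {G : SSG B} : ∀ {ts : SandTreeList B},
    G ∈ semOr ts ↔ ∃ t ∈ ts.toList, G ∈ sem t
  | .single t => by simp [semOr, SandTreeList.toList]
  | .cons t ts => by simp [semOr, SandTreeList.toList, mem_semOr_iff]

theorem exists_semAnd_append {G' : SSG B} {ts' : SandTreeList B} (hG' : G' ∈ semAnd ts') :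
    ∀ {ts : SandTreeList B} {G : SSG B}, G ∈ semAnd ts →
      ∃ us : SandTreeList B, us.toList = ts.toList ++ ts'.toList ∧ G.par G' ∈ semAnd us
  | .single t, G, hG => ⟨.cons t ts', rfl, G, hG, G', hG', .refl _⟩
  | .cons t ts, G, ⟨G₁, h₁, G₂, h₂, h⟩ => by
      obtain ⟨us, hus, hG₂⟩ := exists_semAnd_append hG' h₂
      exact ⟨.cons t us, by simp [SandTreeList.toList, hus], G₁, h₁, _, hG₂,
        (SSG.par_assoc_iso G₁ G₂ G').symm.trans (h.par (.refl G'))⟩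

theorem exists_semSand_append {G' : SSG B} {ts' : SandTreeList B} (hG' : G' ∈ semSand ts') :
    ∀ {ts : SandTreeList B} {G : SSG B}, G ∈ semSand ts →
      ∃ us : SandTreeList B, us.toList = ts.toList ++ ts'.toList ∧ G.seq G' ∈ semSand us
  | .single t, G, hG => ⟨.cons t ts', rfl, G, hG, G', hG', .refl _⟩
  | .cons t ts, G, ⟨G₁, h₁, G₂, h₂, h⟩ => by
      obtain ⟨us, hus, hG₂⟩ := exists_semSand_append hG' h₂
      exact ⟨.cons t us, by simp [SandTreeList.toList, hus], G₁, h₁, _, hG₂,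
        (SSG.seq_assoc_iso G₁ G₂ G').symm.trans (h.seq (.refl G'))⟩

theorem IsA.exists_isS_semAnd {t : SandTree B} (ht : IsA t) {G : SSG B} (hG : G ∈ sem t) :
    ∃ ts : SandTreeList B, (∀ u ∈ ts.toList, IsS u) ∧ G ∈ semAnd ts := by
  rcases ht.cases with ⟨b, rfl⟩ | ⟨ts, rfl, hl, h⟩ | ⟨ts, rfl, hl, h⟩
  · exact ⟨.single (.atom b), by simpa [SandTreeList.toList] using IsS.atom b, hG⟩
  · exact ⟨ts, h, hG⟩
  · exact ⟨.single (.sand ts), by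
      simpa [SandTreeList.toList] using IsS.sand hl (SandTreeList.isCL_of_forall_isC h), hG⟩

theorem IsA.exists_isC_semSand {t : SandTree B} (ht : IsA t) {G : SSG B} (hG : G ∈ sem t) :
    ∃ ts : SandTreeList B, (∀ u ∈ ts.toList, IsC u) ∧ G ∈ semSand ts := by
  rcases ht.cases with ⟨b, rfl⟩ | ⟨ts, rfl, hl, h⟩ | ⟨ts, rfl, hl, h⟩
  · exact ⟨.single (.atom b), by simpa [SandTreeList.toList] using IsC.atom b, hG⟩
  · exact ⟨.single (.and ts), by
      simpa [SandTreeList.toList] using IsC.and hl (SandTreeList.isSL_of_forall_isS h), hG⟩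
  · exact ⟨ts, h, hG⟩

theorem two_le_length_append (ts ts' : SandTreeList B) :
    2 ≤ (ts.toList ++ ts'.toList).length := by
  have := List.length_pos_iff.2 ts.toList_ne_nil
  have := List.length_pos_iff.2 ts'.toList_ne_nil
  rw [List.length_append]
  omega

/-- Every SP graph is denoted by an `OR`-free normal form. -/
theorem SSG.IsSP.exists_isA {G : SSG B} (h : G.IsSP) : ∃ t, IsA t ∧ G ∈ sem t := by
  induction h with
  | single b => exact ⟨.atom b, .inl (.atom b), .refl _⟩
  | seq _ _ ih ih' =>
    obtain ⟨t, ht, hG⟩ := ih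
    obtain ⟨t', ht', hG'⟩ := ih'
    obtain ⟨ts, hts, hG⟩ := ht.exists_isC_semSand hG
    obtain ⟨ts', hts', hG'⟩ := ht'.exists_isC_semSand hG'
    obtain ⟨us, hus, h⟩ := exists_semSand_append hG' hG
    refine ⟨.sand us, .inr (.sand (hus ▸ two_le_length_append ts ts')
      (SandTreeList.isCL_of_forall_isC fun u hu => ?_)), h⟩
    rw [hus, List.mem_append] at hu
    exact hu.elim (hts u) (hts' u)
  | par _ _ ih ih' =>
    obtain ⟨t, ht, hG⟩ := ih
    obtain ⟨t', ht', hG'⟩ := ih'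
    obtain ⟨ts, hts, hG⟩ := ht.exists_isS_semAnd hG
    obtain ⟨ts', hts', hG'⟩ := ht'.exists_isS_semAnd hG'
    obtain ⟨us, hus, h⟩ := exists_semAnd_append hG' hG
    refine ⟨.and us, .inl (.and (hus ▸ two_le_length_append ts ts')
      (SandTreeList.isSL_of_forall_isS fun u hu => ?_)), h⟩
    rw [hus, List.mem_append] at hu
    exact hu.elim (hts u) (hts' u)
  | iso _ h ih =>
    obtain ⟨t, ht, hG⟩ := ih
    exact ⟨t, ht, mem_sem_of_iso t h hG⟩

/-- Induction on `OR`-free normal forms. -/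
theorem IsA.induct {P : SandTree B → Prop} (atom : ∀ b, P (.atom b))
    (and : ∀ ts : SandTreeList B, (∀ u ∈ ts.toList, P u) → P (.and ts))
    (sand : ∀ ts : SandTreeList B, (∀ u ∈ ts.toList, P u) → P (.sand ts)) :
    ∀ t : SandTree B, IsA t → P t
  | .atom b, _ => atom b
  | .or ts, h => by rcases h with h | h <;> cases h
  | .and ts, h => and ts fun u hu => by
      have := SandTreeList.sizeOf_lt_of_mem_toList hu
      refine IsA.induct atom and sand u (.inr ?_)
      rcases h with h | h <;> cases h
      exact SandTreeList.forall_isS_of_isSL ‹_› u hu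
  | .sand ts, h => sand ts fun u hu => by
      have := SandTreeList.sizeOf_lt_of_mem_toList hu
      refine IsA.induct atom and sand u (.inl ?_)
      rcases h with h | h <;> cases h
      exact SandTreeList.forall_isC_of_isCL ‹_› u hu
termination_by t => sizeOf t
decreasing_by
  all_goals
    simp only [SandTree.and.sizeOf_spec, SandTree.sand.sizeOf_spec]
    omega

theorem iso_of_mem_semAnd : ∀ {ts : SandTreeList B},
    (∀ t ∈ ts.toList, ∀ G ∈ sem t, ∀ H ∈ sem t, G.Iso H) →
      ∀ G ∈ semAnd ts, ∀ H ∈ semAnd ts, G.Iso H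
  | .single t, h => h t (by simp [SandTreeList.toList])
  | .cons t ts, h => by
      rintro G ⟨G₁, h₁, G₂, h₂, hG⟩ H ⟨H₁, h₁', H₂, h₂', hH⟩
      refine hG.symm.trans ((SSG.Iso.par (h t (by simp [SandTreeList.toList]) _ h₁ _ h₁')
        (iso_of_mem_semAnd (fun u hu => h u ?_) _ h₂ _ h₂')).trans hH)
      simp [SandTreeList.toList, hu]

theorem iso_of_mem_semSand : ∀ {ts : SandTreeList B},
    (∀ t ∈ ts.toList, ∀ G ∈ sem t, ∀ H ∈ sem t, G.Iso H) →
      ∀ G ∈ semSand ts, ∀ H ∈ semSand ts, G.Iso H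
  | .single t, h => h t (by simp [SandTreeList.toList])
  | .cons t ts, h => by
      rintro G ⟨G₁, h₁, G₂, h₂, hG⟩ H ⟨H₁, h₁', H₂, h₂', hH⟩
      refine hG.symm.trans ((SSG.Iso.seq (h t (by simp [SandTreeList.toList]) _ h₁ _ h₁')
        (iso_of_mem_semSand (fun u hu => h u ?_) _ h₂ _ h₂')).trans hH)
      simp [SandTreeList.toList, hu]

theorem IsA.iso_of_mem_sem {t : SandTree B} (ht : IsA t) :
    ∀ G ∈ sem t, ∀ H ∈ sem t, G.Iso H := by
  refine IsA.induct (P := fun t => ∀ G ∈ sem t, ∀ H ∈ sem t, G.Iso H) ?_ ?_ ?_ t ht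
  · exact fun b G hG H hH => SSG.Iso.trans (SSG.Iso.symm hG) hH
  · exact fun ts => iso_of_mem_semAnd
  · exact fun ts => iso_of_mem_semSand

theorem IsA.mem_sem_iff {t : SandTree B} (ht : IsA t) {G H : SSG B} (hG : G ∈ sem t) :
    H ∈ sem t ↔ G.Iso H :=
  ⟨ht.iso_of_mem_sem G hG H, fun h => mem_sem_of_iso t h hG⟩

theorem SSG.Iso.isFlow_and_sprepAnd {G H : SSG B} {l : List (SandTree B)} (h : G.Iso H)
    (hG : G.IsFlow ∧ SPRepAnd G.edgeRel (·.2.1) l G.E) :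
    H.IsFlow ∧ SPRepAnd H.edgeRel (·.2.1) l H.E := by
  obtain ⟨hH, i, hi, hE⟩ := h.isFlow_and_embedding hG.1
  exact ⟨hH, hE ▸ hG.2.map (fun _ => rfl) fun _ _ _ _ => hi _ _⟩

theorem SSG.Iso.isFlow_and_sprepSand {G H : SSG B} {l : List (SandTree B)} (h : G.Iso H)
    (hG : G.IsFlow ∧ SPRepSand G.edgeRel (·.2.1) l G.E) :
    H.IsFlow ∧ SPRepSand H.edgeRel (·.2.1) l H.E := by
  obtain ⟨hH, i, hi, hE⟩ := h.isFlow_and_embedding hG.1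
  exact ⟨hH, hE ▸ hG.2.map (fun _ => rfl) fun _ _ _ _ => hi _ _⟩

theorem isFlow_and_sprepAnd : ∀ {ts : SandTreeList B},
    (∀ t ∈ ts.toList, ∀ G ∈ sem t, G.IsFlow ∧ SPRep G.edgeRel (·.2.1) t G.E) →
      ∀ G ∈ semAnd ts, G.IsFlow ∧ SPRepAnd G.edgeRel (·.2.1) ts.toList G.E
  | .single t, h, G, hG => by
      obtain ⟨hF, hr⟩ := h t (by simp [SandTreeList.toList]) G hG
      exact ⟨hF, by simpa [SandTreeList.toList] using SPRepAnd.cons hr .nil (by simp [Unrelated])⟩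
  | .cons t ts, h, G, ⟨G₁, h₁, G₂, h₂, hG⟩ => by
      obtain ⟨hF, hr⟩ := h t (by simp [SandTreeList.toList]) G₁ h₁
      obtain ⟨hF', hr'⟩ := isFlow_and_sprepAnd
        (fun u hu => h u (by simp [SandTreeList.toList, hu])) G₂ h₂
      have d := SSG.parDec_par G₁ G₂
      exact hG.isFlow_and_sprepAnd ⟨d.isFlow hF hF', .cons
        (hr.map (fun _ => rfl) fun _ _ _ _ => d.reach_left_iff hF hF' _ _)
        (hr'.map (fun _ => rfl) fun _ _ _ _ => d.symm.reach_left_iff hF' hF _ _)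
        (d.unrelated hF hF')⟩

theorem isFlow_and_sprepSand : ∀ {ts : SandTreeList B},
    (∀ t ∈ ts.toList, ∀ G ∈ sem t, G.IsFlow ∧ SPRep G.edgeRel (·.2.1) t G.E) →
      ∀ G ∈ semSand ts, G.IsFlow ∧ SPRepSand G.edgeRel (·.2.1) ts.toList G.E
  | .single t, h, G, hG => by
      obtain ⟨hF, hr⟩ := h t (by simp [SandTreeList.toList]) G hG
      exact ⟨hF, by simpa [SandTreeList.toList] using SPRepSand.prepend hr .empty (by simp [Precedes])⟩
  | .cons t ts, h, G, ⟨G₁, h₁, G₂, h₂, hG⟩ => by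
      obtain ⟨hF, hr⟩ := h t (by simp [SandTreeList.toList]) G₁ h₁
      obtain ⟨hF', hr'⟩ := isFlow_and_sprepSand
        (fun u hu => h u (by simp [SandTreeList.toList, hu])) G₂ h₂
      have d := SSG.seqDec_seq G₁ G₂
      exact hG.isFlow_and_sprepSand ⟨d.isFlow hF hF', .prepend
        (hr.map (fun _ => rfl) fun _ _ _ _ => d.reach_left_iff _ _)
        (hr'.map (fun _ => rfl) fun _ _ _ _ => d.reach_right_iff _ _)
        (d.precedes hF hF')⟩

theorem IsA.isFlow_and_sprep {t : SandTree B} (ht : IsA t) :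
    ∀ G ∈ sem t, G.IsFlow ∧ SPRep G.edgeRel (·.2.1) t G.E := by
  refine IsA.induct (P := fun t => ∀ G ∈ sem t, G.IsFlow ∧ SPRep G.edgeRel (·.2.1) t G.E)
    ?_ ?_ ?_ t ht
  · intro b G hG
    obtain ⟨hF, i, hi, hE⟩ := SSG.Iso.isFlow_and_embedding hG (SSG.isFlow_single b)
    exact ⟨hF, hE ▸ (SPRep.atom (false, b, true)).map (r := (SSG.single b).edgeRel)
      (lab := (·.2.1)) (fun _ => rfl) fun _ _ _ _ => hi _ _⟩
  · exact fun ts h G hG => (isFlow_and_sprepAnd h G hG).imp_right .and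
  · exact fun ts h G hG => (isFlow_and_sprepSand h G hG).imp_right .sand

/-- `OR`-free normal forms denoting a common graph are equal up to commutativity. -/
theorem IsA.peq_of_mem_sem {t u : SandTree B} (ht : IsA t) (hu : IsA u) {G : SSG B}
    (hGt : G ∈ sem t) (hGu : G ∈ sem u) : PEq t u := by
  obtain ⟨hF, hr⟩ := ht.isFlow_and_sprep G hGt
  exact hr.peq ht hu (hu.isFlow_and_sprep G hGu).2 hF.edgeRel_asymm

theorem semAnd_subset_of_perm {l l' : List (SandTree B)} (h : l.Perm l') :
    ∀ {ts ts' : SandTreeList B}, ts.toList = l → ts'.toList = l' → semAnd ts ⊆ semAnd ts' := by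
  induction h with
  | nil => exact fun h => absurd h (SandTreeList.toList_ne_nil _)
  | cons x hl ih =>
    rintro (t | ⟨t, ts⟩) (t' | ⟨t', ts'⟩) h h' <;>
      simp only [SandTreeList.toList, List.cons.injEq] at h h' <;>
      obtain ⟨rfl, h⟩ := h <;> obtain ⟨rfl, h'⟩ := h'
    · exact subset_rfl
    · subst h
      exact absurd (h'.trans hl.nil_eq.symm) ts'.toList_ne_nil
    · subst h'
      exact absurd (h.trans hl.eq_nil) ts.toList_ne_nil
    · rintro G ⟨G₁, h₁, G₂, h₂, hG⟩
      exact ⟨G₁, h₁, G₂, ih h h' h₂, hG⟩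
  | swap x y l =>
    rintro (t | ⟨t, t₂ | ⟨t₂, ts⟩⟩) (t' | ⟨t', t₂' | ⟨t₂', ts'⟩⟩) h h' <;>
      simp only [SandTreeList.toList, List.cons.injEq, reduceCtorEq, and_false] at h h' <;>
      obtain ⟨rfl, rfl, h⟩ := h <;> obtain ⟨rfl, rfl, h'⟩ := h'
    · rintro G ⟨G₁, h₁, G₂, h₂, hG⟩
      exact ⟨G₂, h₂, G₁, h₁, (SSG.par_comm_iso _ _).trans hG⟩
    · exact absurd (h'.trans h.symm) ts'.toList_ne_nil
    · exact absurd (h.trans h'.symm) ts.toList_ne_nil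
    · obtain rfl := SandTreeList.toList_injective (h.trans h'.symm)
      rintro G ⟨G₁, h₁, G₂, ⟨H₁, h₂, H₂, h₃, hH⟩, hG⟩
      exact ⟨H₁, h₂, _, ⟨G₁, h₁, H₂, h₃, .refl _⟩, (SSG.par_left_comm_iso _ _ _).trans
        (((SSG.Iso.refl _).par hH).trans hG)⟩
  | trans h₁ h₂ ih₁ ih₂ =>
    intro ts ts' h h'
    obtain ⟨us, hus⟩ := SandTreeList.exists_toList_eq fun hn =>
      ts.toList_ne_nil (h.trans (h₁.trans (.of_eq hn)).eq_nil)
    exact (ih₁ h hus).trans (ih₂ hus h')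

/-- The SP semantics respects commutativity of `OR` and `AND`. -/
theorem PEq.sem_eq {t u : SandTree B} (h : PEq t u) : sem t = sem u := by
  induction h using PEq.rec
    (motive_2 := fun ts us _ => semOr ts = semOr us ∧ semAnd ts = semAnd us ∧
      semSand ts = semSand us) with
  | refl => rfl
  | symm _ ih => exact ih.symm
  | trans _ _ ih ih' => exact ih.trans ih'
  | orPerm h => exact Set.ext fun G => by simp [sem, mem_semOr_iff, h.mem_iff]
  | andPerm h =>
    exact (semAnd_subset_of_perm h rfl rfl).antisymm (semAnd_subset_of_perm h.symm rfl rfl)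
  | orCongr _ ih => exact ih.1
  | andCongr _ ih => exact ih.2.1
  | sandCongr _ ih => exact ih.2.2
  | single _ ih => exact ⟨ih, ih, ih⟩
  | cons _ _ ih ihs => simp [semOr, semAnd, semSand, ih, ihs]

end Semantics

section Cover

variable {α : Type*} {R : α → α → Prop}

theorem exists_forall₂_perm_of_cover (hsymm : ∀ {a b}, R a b → R b a)
    (htrans : ∀ {a b c}, R a b → R b c → R a c) {l₁ l₂ : List α}
    (h₁ : l₁.Pairwise fun a b => ¬ R a b) (h₂ : l₂.Pairwise fun a b => ¬ R a b)
    (h : ∀ a ∈ l₁, ∃ b ∈ l₂, R a b) (h' : ∀ b ∈ l₂, ∃ a ∈ l₁, R a b) :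
    ∃ l, List.Forall₂ R l₁ l ∧ l.Perm l₂ := by
  induction l₁ generalizing l₂ with
  | nil =>
    obtain rfl : l₂ = [] := List.eq_nil_iff_forall_not_mem.2 fun b hb => by simpa using h' b hb
    exact ⟨[], .nil, .nil⟩
  | cons a l₁ ih =>
    obtain ⟨b, hb, hab⟩ := h a List.mem_cons_self
    obtain ⟨s, t, rfl⟩ := List.append_of_mem hb
    have hp : (s ++ b :: t).Perm (b :: (s ++ t)) := List.perm_middle
    rw [List.pairwise_cons] at h₁
    rw [hp.pairwise_iff fun h h' => h (hsymm h'), List.pairwise_cons] at h₂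
    obtain ⟨l, hl, hl'⟩ := ih h₁.2 h₂.2
      (fun a' ha' => by
        obtain ⟨b', hb', hab'⟩ := h a' (List.mem_cons_of_mem a ha')
        rcases List.mem_cons.1 (hp.mem_iff.1 hb') with rfl | hb'
        · exact absurd (htrans hab (hsymm hab')) (h₁.1 a' ha')
        · exact ⟨b', hb', hab'⟩)
      (fun b' hb' => by
        obtain ⟨a', ha', hab'⟩ := h' b' (hp.mem_iff.2 (List.mem_cons_of_mem b hb'))
        rcases List.mem_cons.1 ha' with rfl | ha'
        · exact absurd (htrans (hsymm hab) hab') (h₂.1 b' hb')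
        · exact ⟨a', ha', hab'⟩)
    exact ⟨b :: l, .cons hab hl, (hl'.cons b).trans hp.symm⟩

theorem exists_pairwise_not_cover (hrefl : ∀ a, R a a) (l : List α) :
    ∃ l', l' ⊆ l ∧ (l'.Pairwise fun a b => ¬ R a b) ∧ ∀ a ∈ l, ∃ b ∈ l', R a b := by
  induction l with
  | nil => exact ⟨[], by simp⟩
  | cons a l ih =>
    obtain ⟨l', hs, hp, hc⟩ := ih
    by_cases ha : ∃ b ∈ l', R a b
    · exact ⟨l', List.subset_cons_of_subset a hs, hp, List.forall_mem_cons.2 ⟨ha, hc⟩⟩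
    · push Not at ha
      refine ⟨a :: l', List.cons_subset_cons a hs, List.pairwise_cons.2 ⟨ha, hp⟩,
        List.forall_mem_cons.2 ⟨⟨a, List.mem_cons_self, hrefl a⟩, fun c hc' => ?_⟩⟩
      obtain ⟨b, hb, hcb⟩ := hc c hc'
      exact ⟨b, List.mem_cons_of_mem a hb, hcb⟩

end Cover

section NormalForms

variable {B : Type}

/-- The alternatives of a normal form, which is one of them or their disjunction. -/
theorem IsN.exists_list {n : SandTree B} (h : IsN n) :
    ∃ l : List (SandTree B), (∀ a ∈ l, IsA a) ∧ (l.Pairwise fun a b => ¬ PEq a b) ∧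
      (∀ G, G ∈ sem n ↔ ∃ a ∈ l, G ∈ sem a) ∧
      (l = [n] ∨ 2 ≤ l.length ∧ ∃ ts : SandTreeList B, n = .or ts ∧ ts.toList = l) := by
  rcases h with h | ⟨ts, rfl, hl, hA, hp⟩
  · exact ⟨[n], by simpa, by simp, by simp, .inl rfl⟩
  · exact ⟨ts.toList, hA, hp, fun G => mem_semOr_iff, .inr ⟨hl, ts, rfl, rfl⟩⟩

theorem IsN.peq_of_sem_eq {n₁ n₂ : SandTree B} (h₁ : IsN n₁) (h₂ : IsN n₂)
    (h : sem n₁ = sem n₂) : PEq n₁ n₂ := by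
  obtain ⟨l₁, hA₁, hp₁, hs₁, hn₁⟩ := h₁.exists_list
  obtain ⟨l₂, hA₂, hp₂, hs₂, hn₂⟩ := h₂.exists_list
  have hs : ∀ G, (∃ a ∈ l₁, G ∈ sem a) ↔ ∃ a ∈ l₂, G ∈ sem a := fun G => by
    rw [← hs₁, ← hs₂, h]
  obtain ⟨l, hl, hl'⟩ := exists_forall₂_perm_of_cover (R := PEq) PEq.symm PEq.trans hp₁ hp₂
    (fun a ha => by
      obtain ⟨G, hG⟩ := sem_nonempty a
      obtain ⟨b, hb, hGb⟩ := (hs G).1 ⟨a, ha, hG⟩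
      exact ⟨b, hb, (hA₁ a ha).peq_of_mem_sem (hA₂ b hb) hG hGb⟩)
    (fun b hb => by
      obtain ⟨G, hG⟩ := sem_nonempty b
      obtain ⟨a, ha, hGa⟩ := (hs G).2 ⟨b, hb, hG⟩
      exact ⟨a, ha, (hA₁ a ha).peq_of_mem_sem (hA₂ b hb) hGa hG⟩)
  have hlen : l₁.length = l₂.length := hl.length_eq.trans hl'.length_eq
  rcases hn₁ with rfl | ⟨hl₁, ts₁, rfl, rfl⟩ <;> rcases hn₂ with rfl | ⟨hl₂, ts₂, rfl, rfl⟩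
  · rw [List.perm_singleton.1 hl'] at hl
    exact (List.forall₂_cons.1 hl).1
  · exact absurd hl₂ (by simp [← hlen])
  · exact absurd hl₁ (by simp [hlen])
  · obtain ⟨us, rfl, hus⟩ := SandTreeList.exists_peqL_of_forall₂ hl
    exact (PEq.orCongr hus).trans (.orPerm hl')

theorem exists_isN_sem_eq {Gs : List (SSG B)} (hne : Gs ≠ []) (hGs : ∀ G ∈ Gs, G.IsSP) :
    ∃ n : SandTree B, IsN n ∧ sem n = {H | ∃ G ∈ Gs, G.Iso H} := by
  choose f hf hGf using fun G : {G // G ∈ Gs} => (hGs G.1 G.2).exists_isA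
  obtain ⟨l, hl, hp, hc⟩ := exists_pairwise_not_cover PEq.refl (Gs.attach.map f)
  have hA : ∀ a ∈ l, IsA a := fun a ha => by
    obtain ⟨G, -, rfl⟩ := List.mem_map.1 (hl ha)
    exact hf G
  have hmem : ∀ H, (∃ a ∈ l, H ∈ sem a) ↔ ∃ G ∈ Gs, G.Iso H := fun H => by
    constructor
    · rintro ⟨a, ha, hH⟩
      obtain ⟨G, -, rfl⟩ := List.mem_map.1 (hl ha)
      exact ⟨G, G.2, ((hf G).mem_sem_iff (hGf G)).1 hH⟩
    · rintro ⟨G, hG, hH⟩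
      obtain ⟨a, ha, hGa⟩ := hc _ (List.mem_map_of_mem (Gs.mem_attach ⟨G, hG⟩))
      refine ⟨a, ha, ?_⟩
      rw [← hGa.sem_eq, (hf _).mem_sem_iff (hGf _)]
      exact hH
  have hln : l ≠ [] := fun h => by
    obtain ⟨G, hG⟩ := List.exists_mem_of_ne_nil Gs hne
    obtain ⟨a, ha, -⟩ := hc _ (List.mem_map_of_mem (Gs.mem_attach ⟨G, hG⟩))
    simp [h] at ha
  obtain ⟨ts, rfl⟩ := SandTreeList.exists_toList_eq hln
  have hsem : semOr ts = {H | ∃ G ∈ Gs, G.Iso H} := Set.ext fun H => mem_semOr_iff.trans (hmem H)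
  cases ts with
  | single t => exact ⟨t, .inl (hA t (by simp [SandTreeList.toList])), hsem⟩
  | cons t ts =>
    refine ⟨.or (.cons t ts), .inr ⟨_, rfl, ?_, hA, hp⟩, hsem⟩
    have := List.length_pos_iff.2 ts.toList_ne_nil
    simp only [SandTreeList.toList, List.length_cons]
    omega

end NormalForms

/-- Lemma 1: the restriction of `⟦·⟧` to `N`-terms is a bijection
onto the collection of nonempty finite sets of SP graphs (sets of SP graphs are
represented by the isomorphism-closure of a nonempty finite list of SP graphs;
injectivity of terms is modulo commutativity of `OR` and `AND`). -/
theorem semN_bijective (B : Type) :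
    (∀ n1 n2 : SandTree B, IsN n1 → IsN n2 → sem n1 = sem n2 → PEq n1 n2) ∧
    (∀ S : Set (SSG B),
      (∃ Gs : List (SSG B), Gs ≠ [] ∧ (∀ G ∈ Gs, SSG.IsSP G) ∧
          S = {H | ∃ G ∈ Gs, G.Iso H}) →
      ∃ n : SandTree B, IsN n ∧ sem n = S) := by
  refine ⟨fun _ _ h₁ h₂ h => h₁.peq_of_sem_eq h₂ h, ?_⟩
  rintro _ ⟨Gs, hne, hGs, rfl⟩
  exact exists_isN_sem_eq hne hGs
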